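/- arXiv:2507.05371 — 10 statements merged into one kernel-verified Lean document; each statement's English description precedes it below -/
import Mathlib

section
/- Let X be a sequential, perfectly normal, Hausdorff topological space. Let J be a collection of subsets of X that is downward closed (if A ∈ J and B ⊆ A then B ∈ J), closed under countable unions, and invariant under homeomorphisms of X (if A ∈ J and h is a self-homeomorphism of X then h '' A ∈ J). Let I = {A ⊆ X : closure A ∈ J}. Assume (X, I) is tight, witnessed by homeomorphisms: for every a ∈ I there is a closed a' ∈ I with a ⊆ a' such that for every b ∈ I and every open set U ⊇ a' there is a self-homeomorphism h of X fixing a' pointwise with h '' b ⊆ U. Then for every a ∈ I and every sequence (b_i)_{i∈ℕ} of sets in I there exist self-homeomorphisms h_i of X, each fixing a pointwise, such that ⋃_{i∈ℕ} h_i '' b_i ∈ I. -/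
/-- If `X` is a sequential, perfectly normal, Hausdorff space,
`J` is a σ-ideal-like family (downward closed, closed under countable unions,
invariant under self-homeomorphisms), `I = {A | closure A ∈ J}`, and `(X, I)`
is tight (witnessed by homeomorphisms), then the dynamical ideal is
dynamically σ-complete. -/
theorem stmt0 {X : Type*} [TopologicalSpace X] [SequentialSpace X]
    [PerfectlyNormalSpace X] [T2Space X]
    (J : Set (Set X))
    (hdown : ∀ A ∈ J, ∀ B ⊆ A, B ∈ J)
    (hunion : ∀ f : ℕ → Set X, (∀ i, f i ∈ J) → (⋃ i, f i) ∈ J)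
    (hinv : ∀ A ∈ J, ∀ h : X ≃ₜ X, h '' A ∈ J)
    (I : Set (Set X)) (hI : I = {A : Set X | closure A ∈ J})
    (htight : ∀ a ∈ I, ∃ a' ∈ I, IsClosed a' ∧ a ⊆ a' ∧
      ∀ b ∈ I, ∀ U : Set X, IsOpen U → a' ⊆ U →
        ∃ h : X ≃ₜ X, (∀ x ∈ a', h x = x) ∧ h '' b ⊆ U) :
    ∀ a ∈ I, ∀ b : ℕ → Set X, (∀ i, b i ∈ I) →
      ∃ h : ℕ → X ≃ₜ X, (∀ i, ∀ x ∈ a, h i x = x) ∧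
        (⋃ i, (h i) '' (b i)) ∈ I := by
  subst hI
  intro a ha b hb
  obtain ⟨a', ha'J, ha'cl, haa', hmove⟩ := htight a ha
  obtain ⟨f, hfa, hf⟩ := perfectlyNormalSpace_iff_forall_isClosed_preimage_zero.mp ‹_› a' ha'cl
  have hpos : ∀ n : ℕ, (0 : ℝ) < 1 / ((n : ℝ) + 1) := fun _ => Nat.one_div_pos_of_nat
  have hstep : ∀ n, ∃ h : X ≃ₜ X, (∀ x ∈ a', h x = x) ∧
      h '' closure (b n) ⊆ {x | f x < 1 / ((n : ℝ) + 1)} := fun n =>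
    hmove _ (by simpa using hb n) _ (isOpen_lt f.continuous continuous_const) fun x hx => by
      rw [hfa] at hx
      simpa [show f x = 0 from hx] using hpos n
  choose h hfix hsub using hstep
  refine ⟨h, fun i x hx => hfix i x (haa' hx), ?_⟩
  have haJ : a' ∈ J := by simpa [ha'cl.closure_eq] using ha'J
  have hJ : (⋃ n : ℕ, Nat.casesOn n a' (fun i => h i '' closure (b i)) : Set X) ∈ J :=
    hunion _ fun n => by
      cases n with
      | zero => exact haJ
      | succ i => exact hinv _ (hb i) (h i)
  refine hdown _ hJ _ fun x hx => ?_
  by_cases hK : ∃ i, x ∈ h i '' closure (b i)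
  · obtain ⟨i, hi⟩ := hK
    exact Set.mem_iUnion.mpr ⟨i + 1, hi⟩
  refine Set.mem_iUnion.mpr ⟨0, ?_⟩
  have hle : ∀ n : ℕ, f x ≤ 1 / ((n : ℝ) + 1) := by
    intro n
    have hclosed : IsClosed ({y | f y ≤ 1 / ((n : ℝ) + 1)} ∪
        ⋃ i ∈ Set.Iio n, h i '' closure (b i)) :=
      (isClosed_le f.continuous continuous_const).union <|
        (Set.finite_Iio n).isClosed_biUnion fun i _ => (h i).isClosedMap _ isClosed_closure
    have hcover : (⋃ i, h i '' b i) ⊆ {y | f y ≤ 1 / ((n : ℝ) + 1)} ∪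
        ⋃ i ∈ Set.Iio n, h i '' closure (b i) := by
      refine Set.iUnion_subset fun i y hy => ?_
      have hy' := Set.image_mono subset_closure hy
      rcases lt_or_ge i n with hin | hin
      · exact Or.inr (Set.mem_biUnion (Set.mem_Iio.mpr hin) hy')
      · have hlt : f y < 1 / ((i : ℝ) + 1) := hsub i hy'
        exact Or.inl (show f y ≤ _ from hlt.le.trans (Nat.one_div_le_one_div hin))
    rcases closure_minimal hcover hclosed hx with hx' | hx'
    · exact hx'
    · obtain ⟨i, -, hi⟩ := Set.mem_iUnion₂.mp hx'
      exact absurd ⟨i, hi⟩ hK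
  change x ∈ a'
  rw [hfa]
  exact le_antisymm
    (ge_of_tendsto' tendsto_one_div_add_atTop_nhds_zero_nat hle) (hf x).1
end

section
/- Let X be a sequential, perfectly normal, Hausdorff, weakly locally compact topological space (every point has a compact neighborhood). Let J be a collection of subsets of X that is downward closed, closed under countable unions, and invariant under homeomorphisms of X. Let I = {A ⊆ X : closure A is compact and closure A ∈ J}. Assume that for every a ∈ I there is a closed a' ∈ I with a ⊆ a' such that for every b ∈ I and every open set U ⊇ a' there is a self-homeomorphism h of X fixing a' pointwise with h '' b ⊆ U. Then for every a ∈ I and every sequence (b_i)_{i∈ℕ} of sets in I there exist self-homeomorphisms h_i of X, each fixing a pointwise, such that ⋃_{i∈ℕ} h_i '' b_i ∈ I. -/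
/-- In a Hausdorff space, let `s` be the intersection of compact sets `C n`, and let `K` be a sequence
of compact sets with `K i ⊆ C n` whenever `n ≤ i`. Then `s ∪ ⋃ i, K i` is compact. -/
theorem isCompact_iInter_union_iUnion {X : Type*} [TopologicalSpace X] [T2Space X]
    {C K : ℕ → Set X} (hC : ∀ n, IsCompact (C n)) (hK : ∀ i, IsCompact (K i))
    (hKC : ∀ n i, n ≤ i → K i ⊆ C n) :
    IsCompact ((⋂ n, C n) ∪ ⋃ i, K i) := by
  have hcpt (n : ℕ) : IsCompact (C n ∪ ⋃ i ∈ Set.Iio n, K i) :=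
    (hC n).union ((Set.finite_Iio n).isCompact_biUnion fun i _ => hK i)
  have heq : (⋂ n, C n) ∪ ⋃ i, K i = ⋂ n, (C n ∪ ⋃ i ∈ Set.Iio n, K i) := by
    apply Set.Subset.antisymm
    · rintro x (hx | hx) <;> refine Set.mem_iInter.2 fun n => ?_
      · exact Or.inl (Set.mem_iInter.1 hx n)
      · obtain ⟨i, hi⟩ := Set.mem_iUnion.1 hx
        rcases le_or_gt n i with hni | hin
        · exact Or.inl (hKC n i hni hi)
        · exact Or.inr (Set.mem_biUnion (Set.mem_Iio.2 hin) hi)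
    · intro x hx
      by_cases hxK : x ∈ ⋃ i, K i
      · exact Or.inr hxK
      · refine Or.inl (Set.mem_iInter.2 fun n => ?_)
        refine (Set.mem_iInter.1 hx n).resolve_right fun h => hxK ?_
        exact Set.iUnion₂_subset (fun i _ => Set.subset_iUnion K i) h
  rw [heq]
  exact (hcpt 0).of_isClosed_subset (isClosed_iInter fun n => (hcpt n).isClosed)
    (Set.iInter_subset _ 0)

/-- A compact `Gδ` set in a locally compact Hausdorff space is the intersection of a sequence of
compact neighborhoods. -/
theorem IsCompact.exists_isOpen_iInter_closure_eq {X : Type*} [TopologicalSpace X] [T2Space X]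
    [LocallyCompactSpace X] {s : Set X} (hs : IsCompact s) (hG : IsGδ s) :
    ∃ V : ℕ → Set X, (∀ n, IsOpen (V n)) ∧ (∀ n, s ⊆ V n) ∧
      (∀ n, IsCompact (closure (V n))) ∧ ⋂ n, closure (V n) = s := by
  obtain ⟨G, hGo, rfl⟩ := isGδ_iff_eq_iInter_nat.1 hG
  choose V hVo hsV hVG hVc using fun n =>
    exists_open_between_and_isCompact_closure hs (hGo n) (Set.iInter_subset G n)
  exact ⟨V, hVo, hsV, hVc, Set.Subset.antisymm (Set.iInter_mono hVG)
    (Set.subset_iInter fun n => (hsV n).trans subset_closure)⟩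


/-- The compact-sets version of dynamical σ-completeness for
tight ideals on a sequential, perfectly normal, Hausdorff, weakly locally
compact space. -/
theorem stmt1 {X : Type*} [TopologicalSpace X] [SequentialSpace X]
    [PerfectlyNormalSpace X] [T2Space X] [WeaklyLocallyCompactSpace X]
    (J : Set (Set X))
    (hdown : ∀ A ∈ J, ∀ B ⊆ A, B ∈ J)
    (hunion : ∀ f : ℕ → Set X, (∀ i, f i ∈ J) → (⋃ i, f i) ∈ J)
    (hinv : ∀ A ∈ J, ∀ h : X ≃ₜ X, h '' A ∈ J)
    (I : Set (Set X))
    (hI : I = {A : Set X | IsCompact (closure A) ∧ closure A ∈ J})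
    (htight : ∀ a ∈ I, ∃ a' ∈ I, IsClosed a' ∧ a ⊆ a' ∧
      ∀ b ∈ I, ∀ U : Set X, IsOpen U → a' ⊆ U →
        ∃ h : X ≃ₜ X, (∀ x ∈ a', h x = x) ∧ h '' b ⊆ U) :
    ∀ a ∈ I, ∀ b : ℕ → Set X, (∀ i, b i ∈ I) →
      ∃ h : ℕ → X ≃ₜ X, (∀ i, ∀ x ∈ a, h i x = x) ∧
        (⋃ i, (h i) '' (b i)) ∈ I := by
  subst hI
  intro a ha b hb
  obtain ⟨s, ⟨hsc, hsJ⟩, hs_closed, has, hs⟩ := htight a ha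
  rw [hs_closed.closure_eq] at hsc hsJ
  obtain ⟨V, hVo, hsV, hVc, hVs⟩ :=
    hsc.exists_isOpen_iInter_closure_eq (PerfectlyNormalSpace.closed_gdelta hs_closed)
  have hbc (i : ℕ) : closure (b i) ∈ {A : Set X | IsCompact (closure A) ∧ closure A ∈ J} := by
    simpa using hb i
  choose h hfix hsub using fun i => hs (closure (b i)) (hbc i) (⋂ j ∈ Set.Iic i, V j)
    ((Set.finite_Iic i).isOpen_biInter fun j _ => hVo j) (Set.subset_iInter₂ fun j _ => hsV j)
  have hcpt : IsCompact (s ∪ ⋃ i, h i '' closure (b i)) := by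
    rw [← hVs]
    exact isCompact_iInter_union_iUnion hVc (fun i => (hb i).1.image (h i).continuous)
      fun n i hni => (hsub i).trans ((Set.biInter_subset_of_mem (Set.mem_Iic.2 hni)).trans
        subset_closure)
  have hJ : s ∪ ⋃ i, h i '' closure (b i) ∈ J := by
    have := hunion (fun n => Nat.casesOn n s fun i => h i '' closure (b i)) fun n => by
      cases n with
      | zero => exact hsJ
      | succ i => exact hinv _ (hb i).2 (h i)
    rwa [← Set.union_iUnion_nat_succ] at this
  have hcl : closure (⋃ i, h i '' b i) ⊆ s ∪ ⋃ i, h i '' closure (b i) :=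
    closure_minimal ((Set.iUnion_mono fun i => Set.image_mono subset_closure).trans
      Set.subset_union_right) hcpt.isClosed
  exact ⟨h, fun i x hx => hfix i x (has hx), hcpt.of_isClosed_subset isClosed_closure hcl,
    hdown _ hJ _ hcl⟩
end

section
/- Let a and b be countable closed subsets of the Cantor space 2^ω, and let U be a nonempty open subset of 2^ω with a ⊆ U. Then there is a self-homeomorphism h of 2^ω such that h x = x for all x ∈ a and h '' b ⊆ U. -/
open Set Topology

/-- The sequence `z` with its first entries preceded by `y 0, …, y (n - 1)`. -/
def prependPrefix (y : ℕ → Bool) (n : ℕ) (z : ℕ → Bool) : ℕ → Bool :=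
  fun k => if k < n then y k else z (k - n)

theorem continuous_prependPrefix (y : ℕ → Bool) (n : ℕ) : Continuous (prependPrefix y n) := by
  refine continuous_pi fun k => ?_
  unfold prependPrefix
  split_ifs <;> fun_prop

theorem prependPrefix_mem_cylinder (y : ℕ → Bool) (n : ℕ) (z : ℕ → Bool) :
    prependPrefix y n z ∈ PiNat.cylinder y n :=
  fun k hk => by simp [prependPrefix, hk]

theorem shift_prependPrefix (y : ℕ → Bool) (n : ℕ) (z : ℕ → Bool) :
    (fun k => prependPrefix y n z (k + n)) = z := by
  funext k
  simp [prependPrefix]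

theorem prependPrefix_shift {y : ℕ → Bool} {n : ℕ} {z : ℕ → Bool}
    (hz : z ∈ PiNat.cylinder y n) : prependPrefix y n (fun k => z (k + n)) = z := by
  funext k
  by_cases hk : k < n
  · simp [prependPrefix, hk, hz k hk]
  · simp [prependPrefix, hk, Nat.sub_add_cancel (not_lt.1 hk)]

theorem isClopen_cylinder (y : ℕ → Bool) (n : ℕ) : IsClopen (PiNat.cylinder y n) := by
  refine ⟨?_, PiNat.isOpen_cylinder _ y n⟩
  rw [PiNat.cylinder_eq_pi]
  exact isClosed_set_pi fun _ _ => isClosed_discrete _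

theorem exists_cylinder_subset {U : Set (ℕ → Bool)} (hU : IsOpen U) {x : ℕ → Bool} (hx : x ∈ U) :
    ∃ n, PiNat.cylinder x n ⊆ U := by
  obtain ⟨_, ⟨y, n, rfl⟩, hxy, hyU⟩ :=
    (PiNat.isTopologicalBasis_cylinders fun _ => Bool).exists_subset_of_mem_open hx hU
  exact ⟨n, by rwa [PiNat.mem_cylinder_iff_eq.1 hxy]⟩

theorem not_countable_of_isOpen {U : Set (ℕ → Bool)} (hU : IsOpen U) (hne : U.Nonempty) :
    ¬ U.Countable := by
  intro hc
  obtain ⟨x, hx⟩ := hne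
  obtain ⟨n, hn⟩ := exists_cylinder_subset hU hx
  have hinj : Function.Injective (prependPrefix x n) :=
    Function.LeftInverse.injective (g := fun (z : ℕ → Bool) k => z (k + n))
      (shift_prependPrefix x n)
  have hpre : (prependPrefix x n ⁻¹' U) = univ :=
    eq_univ_of_forall fun z => hn (prependPrefix_mem_cylinder x n z)
  have hunc : Uncountable (ℕ → Bool) := by
    rw [← Cardinal.aleph0_lt_mk_iff]
    simpa using Cardinal.cantor Cardinal.aleph0
  have h := hc.preimage hinj
  rw [hpre, countable_univ_iff] at h
  exact not_countable h

open Classical in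
/-- Inverse continuous maps between two disjoint clopen sets give a homeomorphism of the ambient
space that exchanges these sets and is the identity elsewhere. -/
theorem exists_homeomorph_swap {X : Type*} [TopologicalSpace X] {V W : Set X}
    (hV : IsClopen V) (hW : IsClopen W) (hVW : Disjoint V W) {f g : X → X}
    (hf : Continuous f) (hg : Continuous g) (hfV : MapsTo f V W) (hgW : MapsTo g W V)
    (hgf : LeftInvOn g f V) (hfg : LeftInvOn f g W) :
    ∃ h : X ≃ₜ X, (∀ x ∈ V, h x = f x) ∧ (∀ x ∈ W, h x = g x) ∧ ∀ x ∉ V, x ∉ W → h x = x := by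
  let φ : X → X := V.piecewise f (W.piecewise g id)
  have hφV : ∀ x ∈ V, φ x = f x := fun x hx => piecewise_eq_of_mem _ _ _ hx
  have hφW : ∀ x ∈ W, φ x = g x := fun x hx => by
    simp [φ, hVW.notMem_of_mem_right hx, hx]
  have hφ : ∀ x ∉ V, x ∉ W → φ x = x := fun x hxV hxW => by simp [φ, hxV, hxW]
  have hinv : Function.Involutive φ := by
    intro x
    by_cases hxV : x ∈ V
    · rw [hφV x hxV, hφW _ (hfV hxV), hgf hxV]
    · by_cases hxW : x ∈ W
      · rw [hφW x hxW, hφV _ (hgW hxW), hfg hxW]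
      · rw [hφ x hxV hxW, hφ x hxV hxW]
  have hcont : Continuous φ :=
    hf.piecewise (by simp [hV.frontier_eq]) (hg.piecewise (by simp [hW.frontier_eq]) continuous_id)
  exact ⟨⟨hinv.toPerm, hcont, hcont⟩, hφV, hφW, hφ⟩

/-- Tightness of the Cantor space with the ideal of countable
closed sets. -/
theorem stmt2 (a b : Set (ℕ → Bool))
    (ha : a.Countable) (haC : IsClosed a)
    (hb : b.Countable) (hbC : IsClosed b)
    (U : Set (ℕ → Bool)) (hU : IsOpen U) (hUne : U.Nonempty) (haU : a ⊆ U) :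
    ∃ h : (ℕ → Bool) ≃ₜ (ℕ → Bool), (∀ x ∈ a, h x = x) ∧ h '' b ⊆ U := by
  obtain ⟨y, hyU, hy⟩ : (U \ (a ∪ b)).Nonempty := by
    rw [sdiff_nonempty]
    exact fun hsub => not_countable_of_isOpen hU hUne ((ha.union hb).mono hsub)
  obtain ⟨n, hn⟩ := exists_cylinder_subset (hU.sdiff (haC.union hbC)) ⟨hyU, hy⟩
  obtain ⟨C, hC, haC', hCU⟩ := exists_clopen_of_closed_subset_open haC hU haU
  have hcyl := isClopen_cylinder y n
  have hshift : Continuous fun (z : ℕ → Bool) k => z (k + n) := by fun_prop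
  let V : Set (ℕ → Bool) := (C ∪ PiNat.cylinder y n)ᶜ
  let W : Set (ℕ → Bool) := PiNat.cylinder y n ∩ (fun z k => z (k + n)) ⁻¹' V
  have hV : IsClopen V := (hC.union hcyl).compl
  obtain ⟨h, hhV, -, hh⟩ := exists_homeomorph_swap (V := V) (W := W)
    (f := prependPrefix y n) (g := fun z k => z (k + n)) hV
    (hcyl.inter (hV.preimage hshift))
    (disjoint_left.2 fun x hxV hxW => hxV (Or.inr hxW.1))
    (continuous_prependPrefix y n) hshift
    (fun x hx => ⟨prependPrefix_mem_cylinder y n x, by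
      simpa only [mem_preimage, shift_prependPrefix] using hx⟩)
    (fun x hx => hx.2)
    (fun x _ => shift_prependPrefix y n x)
    (fun x hx => prependPrefix_shift hx.1)
  refine ⟨h, fun x hx => hh x (fun hxV => hxV (Or.inl (haC' hx)))
    fun hxW => (hn hxW.1).2 (Or.inl hx), ?_⟩
  rintro _ ⟨x, hx, rfl⟩
  by_cases hxV : x ∈ V
  · rw [hhV x hxV]
    exact (hn (prependPrefix_mem_cylinder y n x)).1
  · rw [hh x hxV fun hxW => (hn hxW.1).2 (Or.inr hx)]
    exact (not_notMem.1 hxV).elim (fun hxC => hCU hxC) fun hxc => (hn hxc).1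
end

section
/- Let n ≥ 1, let a be a countable compact subset of ℝⁿ, and let ε > 0. Then there exist finitely many points c_1, …, c_k belonging to a and radii r_1, …, r_k with 0 < r_j < ε such that the open balls Ball(c_j, r_j) are pairwise disjoint, a ⊆ ⋃_{j≤k} Ball(c_j, r_j), and ⋃_{j≤k} Ball(c_j, r_j) is contained in the ε-thickening {x : dist(x, a) < ε} of a. -/
open Metric Set Filter Topology in
/-- For every `ε > 0`, the set `K` is covered by finitely many pairwise disjoint balls of radius
less than `ε`, centered in `K`, whose bounding spheres avoid `a`. -/
def HasDisjointBallCovers {X : Type*} [MetricSpace X] (a K : Set X) : Prop :=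
  ∀ ε > 0, ∃ s : Set (X × ℝ), s.Finite ∧
    (∀ p ∈ s, p.1 ∈ K ∧ 0 < p.2 ∧ p.2 < ε ∧ Disjoint a (sphere p.1 p.2)) ∧
    s.PairwiseDisjoint (fun p => ball p.1 p.2) ∧
    K ⊆ ⋃ p ∈ s, ball p.1 p.2

namespace HasDisjointBallCovers

open Metric Set Filter Topology

variable {X : Type*} [MetricSpace X] {a K : Set X}

/-- A finite disjoint family of balls centered in `K` extends to a cover of `K` as soon as the
part of `K` that it misses has disjoint ball covers. -/
theorem exists_cover_extend (hK : IsCompact K) (hKa : K ⊆ a) {ε : ℝ} (hε : 0 < ε)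
    {s : Set (X × ℝ)} (hs : s.Finite)
    (hsK : ∀ p ∈ s, p.1 ∈ K ∧ 0 < p.2 ∧ p.2 < ε ∧ Disjoint a (sphere p.1 p.2))
    (hd : s.PairwiseDisjoint (fun p => ball p.1 p.2))
    (h : HasDisjointBallCovers a (K \ ⋃ p ∈ s, ball p.1 p.2)) :
    ∃ s : Set (X × ℝ), s.Finite ∧
      (∀ p ∈ s, p.1 ∈ K ∧ 0 < p.2 ∧ p.2 < ε ∧ Disjoint a (sphere p.1 p.2)) ∧
      s.PairwiseDisjoint (fun p => ball p.1 p.2) ∧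
      K ⊆ ⋃ p ∈ s, ball p.1 p.2 := by
  have hK' : IsCompact (K \ ⋃ p ∈ s, ball p.1 p.2) :=
    hK.diff (isOpen_biUnion fun _ _ => isOpen_ball)
  have hdisj : Disjoint (K \ ⋃ p ∈ s, ball p.1 p.2) (⋃ p ∈ s, closedBall p.1 p.2) := by
    rw [Set.disjoint_left]
    rintro x ⟨hxK, hx⟩ hx'
    simp only [mem_iUnion, exists_prop, not_exists, not_and] at hx hx'
    obtain ⟨p, hp, hxp⟩ := hx'
    rw [← ball_union_sphere] at hxp
    exact hxp.elim (hx p hp) (Set.disjoint_left.1 (hsK p hp).2.2.2 (hKa hxK))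
  obtain ⟨δ, hδ, hδd⟩ := hdisj.exists_thickenings hK'
    (hs.isClosed_biUnion fun _ _ => isClosed_closedBall)
  obtain ⟨t, ht, htK, htd, htc⟩ := h (min ε δ) (lt_min hε hδ)
  refine ⟨s ∪ t, hs.union ht, ?_, ?_, ?_⟩
  · rintro p (hp | hp)
    · exact hsK p hp
    · obtain ⟨h1, h2, h3, h4⟩ := htK p hp
      exact ⟨h1.1, h2, h3.trans_le (min_le_left _ _), h4⟩
  · rw [Set.pairwiseDisjoint_union]
    refine ⟨hd, htd, fun p hp q hq _ => (hδd.mono ?_ ?_).symm⟩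
    · exact (ball_subset_ball ((htK q hq).2.2.1.le.trans (min_le_right _ _))).trans
        (ball_subset_thickening (htK q hq).1 δ)
    · exact ball_subset_closedBall.trans
        ((subset_biUnion_of_mem (u := fun p : X × ℝ => closedBall p.1 p.2) hp).trans
          (self_subset_thickening hδ _))
  · intro x hx
    rw [biUnion_union]
    by_cases hxs : x ∈ ⋃ p ∈ s, ball p.1 p.2
    · exact Or.inl hxs
    · exact Or.inr (htc ⟨hx, hxs⟩)

theorem empty (a : Set X) : HasDisjointBallCovers a ∅ :=
  fun _ _ => ⟨∅, by simp⟩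

/-- For compact subsets of `a`, having disjoint ball covers hereditarily is a local property. -/
theorem of_locally (hK : IsCompact K) (hKa : K ⊆ a)
    (h : ∀ x ∈ K, ∃ r > 0, ∀ L ⊆ closedBall x r ∩ a, IsCompact L → HasDisjointBallCovers a L) :
    HasDisjointBallCovers a K := by
  refine hK.induction_on
    (p := fun t => ∀ L ⊆ closure t ∩ a, IsCompact L → HasDisjointBallCovers a L)
    ?_ ?_ ?_ ?_ K (fun x hx => ⟨subset_closure hx, hKa hx⟩) hK
  · intro L hL _
    rw [closure_empty, empty_inter, subset_empty_iff] at hL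
    exact hL ▸ empty a
  · exact fun s t hst ht L hL => ht L (hL.trans (inter_subset_inter_left a (closure_mono hst)))
  · intro s t hs ht L hL hLc ε hε
    obtain ⟨S, hS, hSL, hSd, hSc⟩ := hs (L ∩ closure s)
      (fun x hx => ⟨hx.2, (hL hx.1).2⟩) (hLc.inter_right isClosed_closure) ε hε
    refine exists_cover_extend hLc (fun x hx => (hL hx).2) hε hS
      (fun p hp => ⟨(hSL p hp).1.1, (hSL p hp).2⟩) hSd (ht _ ?_ ?_)
    · rintro x ⟨hxL, hx⟩
      refine ⟨?_, (hL hxL).2⟩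
      have hst := (hL hxL).1
      rw [closure_union] at hst
      exact hst.resolve_left fun hxs => hx (hSc ⟨hxL, hxs⟩)
    · exact hLc.diff (isOpen_biUnion fun _ _ => isOpen_ball)
  · intro x hx
    obtain ⟨r, hr, hL⟩ := h x hx
    refine ⟨closedBall x r, mem_nhdsWithin_of_mem_nhds (closedBall_mem_nhds x hr), ?_⟩
    rwa [isClosed_closedBall.closure_eq]

/-- If all compact subsets of `K` missing `x` have disjoint ball covers, then so does `K`. -/
theorem of_compact_subset_diff_singleton (ha : a.Countable) (hK : IsCompact K) (hKa : K ⊆ a)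
    (x : X) (h : ∀ L ⊆ K \ {x}, IsCompact L → HasDisjointBallCovers a L) :
    HasDisjointBallCovers a K := by
  by_cases hx : x ∈ K
  · intro ε hε
    obtain ⟨r, hr, hr0, hrε⟩ := ((ha.image fun y => dist y x).dense_compl ℝ).exists_between hε
    refine exists_cover_extend hK hKa hε (finite_singleton (x, r)) ?_
      (pairwiseDisjoint_singleton _ _) (h _ ?_ ?_)
    · rintro _ rfl
      exact ⟨hx, hr0, hrε, Set.disjoint_left.2 fun y hy hyr => hr ⟨y, hy, hyr⟩⟩
    · rw [biUnion_singleton]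
      exact sdiff_subset_sdiff_right (singleton_subset_iff.2 (mem_ball_self hr0))
    · exact hK.diff (isOpen_biUnion fun _ _ => isOpen_ball)
  · exact h K (fun y hy => ⟨hy, fun hyx => hx (hyx ▸ hy)⟩) hK

end HasDisjointBallCovers

open Set Filter Topology in
/-- A nonempty countable closed set in a complete metric space has an isolated point. -/
theorem IsClosed.exists_mem_not_accPt_of_countable {X : Type*} [MetricSpace X] [CompleteSpace X]
    {C : Set X} (hC : IsClosed C) (hc : C.Countable) (hne : C.Nonempty) :
    ∃ x ∈ C, ¬ AccPt x (𝓟 C) := by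
  by_contra! hacc
  obtain ⟨f, hfC, -, hf⟩ := Perfect.exists_nat_bool_injection ⟨hC, hacc⟩ hne
  have : Countable (ℕ → Bool) :=
    countable_univ_iff.1 (countable_of_injective_of_countable_image hf.injOn
      (hc.mono (by rwa [image_univ])))
  have hle := Cardinal.mk_le_aleph0 (α := ℕ → Bool)
  rw [← Cardinal.power_def, Cardinal.mk_bool, Cardinal.mk_nat] at hle
  exact (Cardinal.cantor _).not_ge hle

open Metric Set Filter Topology in
/-- Every countable compact set in a complete metric space has disjoint ball covers. -/
theorem IsCompact.hasDisjointBallCovers {X : Type*} [MetricSpace X] [CompleteSpace X]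
    {a : Set X} (ha : IsCompact a) (hc : a.Countable) : HasDisjointBallCovers a a := by
  let G : Set X := {x | ∃ r > 0, ∀ L ⊆ closedBall x r ∩ a, IsCompact L →
    HasDisjointBallCovers a L}
  have hGo : IsOpen G := by
    rw [Metric.isOpen_iff]
    rintro x ⟨r, hr, h⟩
    refine ⟨r / 2, half_pos hr, fun y hy => ⟨r / 2, half_pos hr, fun L hL => h L (hL.trans ?_)⟩⟩
    refine inter_subset_inter_left a (closedBall_subset_closedBall' ?_)
    linarith [mem_ball.1 hy]
  refine .of_locally ha Subset.rfl fun x hx => ?_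
  by_contra hxG
  obtain ⟨y, hy, hacc⟩ := (ha.diff hGo).isClosed.exists_mem_not_accPt_of_countable
    (hc.mono sdiff_subset) ⟨x, hx, hxG⟩
  rw [accPt_iff_nhds] at hacc
  push Not at hacc
  obtain ⟨U, hU, hUy⟩ := hacc
  obtain ⟨r, hr, hrU⟩ := nhds_basis_closedBall.mem_iff.1 hU
  refine hy.2 ⟨r, hr, fun L hL hLc => .of_compact_subset_diff_singleton hc hLc
    (hL.trans inter_subset_right) y fun M hM hMc => ?_⟩
  refine .of_locally hMc (fun z hz => (hL (hM hz).1).2) fun z hz => ?_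
  by_contra hzG
  have hzL := hL (hM hz).1
  exact (hM hz).2 (hUy z ⟨hrU hzL.1, hzL.2, hzG⟩)


/-- A countable compact subset of ℝⁿ can be covered by finitely
many pairwise disjoint small open balls centered at its points, all contained
in its ε-thickening. -/
theorem stmt6 (n : ℕ) (hn : 1 ≤ n)
    (a : Set (EuclideanSpace ℝ (Fin n)))
    (ha : a.Countable) (hac : IsCompact a)
    (ε : ℝ) (hε : 0 < ε) :
    ∃ (k : ℕ) (c : Fin k → EuclideanSpace ℝ (Fin n)) (r : Fin k → ℝ),
      (∀ j, c j ∈ a) ∧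
      (∀ j, 0 < r j ∧ r j < ε) ∧
      (Pairwise fun j j' => Disjoint (Metric.ball (c j) (r j)) (Metric.ball (c j') (r j'))) ∧
      a ⊆ ⋃ j, Metric.ball (c j) (r j) ∧
      (⋃ j, Metric.ball (c j) (r j)) ⊆ Metric.thickening ε a := by
  obtain ⟨s, hs, hsa, hd, hc⟩ := hac.hasDisjointBallCovers ha ε hε
  have := hs.fintype
  let e := (Fintype.equivFin s).symm
  refine ⟨Fintype.card s, fun j => (e j).1.1, fun j => (e j).1.2, fun j => (hsa _ (e j).2).1,
    fun j => ⟨(hsa _ (e j).2).2.1, (hsa _ (e j).2).2.2.1⟩, fun i j hij => ?_, fun x hx => ?_, ?_⟩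
  · exact hd (e i).2 (e j).2 fun h => hij (e.injective (Subtype.ext h))
  · obtain ⟨p, hp, hxp⟩ := Set.mem_iUnion₂.1 (hc hx)
    exact Set.mem_iUnion.2 ⟨e.symm ⟨p, hp⟩, by simpa using hxp⟩
  · exact Set.iUnion_subset fun j =>
      (Metric.ball_subset_ball (hsa _ (e j).2).2.2.1.le).trans
        (Metric.ball_subset_thickening (hsa _ (e j).2).1 ε)
end

section
/- Let n ≥ 1, let a be a countable compact subset of ℝⁿ, and let 𝒞 be a family of open subsets of ℝⁿ covering a. Then there exist finitely many open balls with rational radii that are pairwise disjoint, cover a, and are each contained in some member of 𝒞. -/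
open Metric MeasureTheory in
/-- A point of an open set of a Euclidean space lies in a ball of rational radius contained in the
open set whose bounding sphere misses a given countable set. -/
theorem exists_rat_ball_subset_sphere_disjoint {n : ℕ} {a U : Set (EuclideanSpace ℝ (Fin n))}
    (ha : a.Countable) (hU : IsOpen U) {x : EuclideanSpace ℝ (Fin n)} (hx : x ∈ U) :
    ∃ (c : EuclideanSpace ℝ (Fin n)) (r : ℚ), 0 < r ∧ x ∈ ball c (r : ℝ) ∧
      ball c (r : ℝ) ⊆ U ∧ Disjoint (sphere c (r : ℝ)) a := by
  obtain ⟨ε, hε, hεU⟩ := Metric.isOpen_iff.1 hU x hx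
  obtain ⟨r, hr0, hrε⟩ := exists_rat_btwn (half_pos hε)
  have hnull : volume (⋃ y ∈ a, sphere y (r : ℝ)) = 0 :=
    (measure_biUnion_null_iff ha).2 fun y _ => Measure.addHaar_sphere_of_ne_zero _ y hr0.ne'
  have hpos : 0 < volume (ball x (r : ℝ)) := measure_ball_pos _ _ hr0
  have hnot : ¬ ball x (r : ℝ) ⊆ ⋃ y ∈ a, sphere y (r : ℝ) := fun h =>
    hpos.ne' (measure_mono_null h hnull)
  obtain ⟨c, hcx, hc⟩ := Set.not_subset.1 hnot
  refine ⟨c, r, by exact_mod_cast hr0, mem_ball_comm.1 hcx, fun z hz => hεU ?_, ?_⟩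
  · have h := dist_triangle z c x
    rw [mem_ball] at hz hcx ⊢
    linarith
  · refine Set.disjoint_left.2 fun y hy hya => hc ?_
    exact Set.mem_biUnion hya (mem_sphere_comm.1 hy)

/-- A finite set of pairs (centre, radius) giving pairwise disjoint balls of positive radius,
subordinate to `𝒞`, whose bounding spheres miss `a`. -/
structure IsDisjointBallFamily {n : ℕ} (a : Set (EuclideanSpace ℝ (Fin n)))
    (𝒞 : Set (Set (EuclideanSpace ℝ (Fin n))))
    (S : Finset (EuclideanSpace ℝ (Fin n) × ℚ)) : Prop where
  pos : ∀ p ∈ S, 0 < p.2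
  pairwiseDisjoint :
    (S : Set (EuclideanSpace ℝ (Fin n) × ℚ)).PairwiseDisjoint fun p => Metric.ball p.1 (p.2 : ℝ)
  subordinate : ∀ p ∈ S, ∃ C ∈ 𝒞, Metric.ball p.1 (p.2 : ℝ) ⊆ C
  sphere_disjoint : ∀ p ∈ S, Disjoint (Metric.sphere p.1 (p.2 : ℝ)) a

open Metric in
/-- A disjoint family of balls can be enlarged so as to cover a further point of `a`. -/
theorem IsDisjointBallFamily.exists_superset {n : ℕ} {a : Set (EuclideanSpace ℝ (Fin n))}
    {𝒞 : Set (Set (EuclideanSpace ℝ (Fin n)))} {S : Finset (EuclideanSpace ℝ (Fin n) × ℚ)}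
    (hS : IsDisjointBallFamily a 𝒞 S) (ha : a.Countable) (h𝒞 : ∀ C ∈ 𝒞, IsOpen C)
    (hcov : a ⊆ ⋃₀ 𝒞) (x : EuclideanSpace ℝ (Fin n)) :
    ∃ T, IsDisjointBallFamily a 𝒞 T ∧ S ⊆ T ∧
      (x ∈ a → x ∈ ⋃ p ∈ T, ball p.1 (p.2 : ℝ)) := by
  classical
  by_cases hx : x ∈ a → x ∈ ⋃ p ∈ S, ball p.1 (p.2 : ℝ)
  · exact ⟨S, hS, subset_rfl, hx⟩
  obtain ⟨hxa, hxS⟩ := Classical.not_imp.1 hx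
  obtain ⟨C, hC, hxC⟩ := hcov hxa
  have hU : IsOpen (C ∩ ⋂ p ∈ S, (closedBall p.1 (p.2 : ℝ))ᶜ) :=
    (h𝒞 C hC).inter (isOpen_biInter_finset fun p _ => isClosed_closedBall.isOpen_compl)
  have hxU : x ∈ C ∩ ⋂ p ∈ S, (closedBall p.1 (p.2 : ℝ))ᶜ := by
    refine ⟨hxC, Set.mem_iInter₂.2 fun p hp hxp => ?_⟩
    rw [← ball_union_sphere] at hxp
    rcases hxp with hxp | hxp
    · exact hxS (Set.mem_biUnion (by exact hp) hxp)
    · exact Set.disjoint_left.1 (hS.sphere_disjoint p hp) hxp hxa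
  obtain ⟨c, r, hr, hxc, hcU, hca⟩ := exists_rat_ball_subset_sphere_disjoint ha hU hxU
  refine ⟨insert (c, r) S, ⟨?_, ?_, ?_, ?_⟩, Finset.subset_insert _ _, fun _ =>
    Set.mem_biUnion (Finset.mem_insert_self (c, r) S) hxc⟩
  · exact (Finset.forall_mem_insert _ _ _).2 ⟨hr, hS.pos⟩
  · rw [Finset.coe_insert]
    refine hS.pairwiseDisjoint.insert fun p hp _ => Set.disjoint_left.2 fun z hz hzp => ?_
    exact Set.mem_iInter₂.1 (hcU hz).2 p hp (ball_subset_closedBall hzp)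
  · exact (Finset.forall_mem_insert _ _ _).2
      ⟨⟨C, hC, hcU.trans Set.inter_subset_left⟩, hS.subordinate⟩
  · exact (Finset.forall_mem_insert _ _ _).2 ⟨hca, hS.sphere_disjoint⟩


/-- Every open cover of a countable compact subset of ℝⁿ can be
refined to a finite cover by pairwise disjoint open balls with rational
radii. -/
theorem stmt7 (n : ℕ) (hn : 1 ≤ n)
    (a : Set (EuclideanSpace ℝ (Fin n)))
    (ha : a.Countable) (hac : IsCompact a)
    (𝒞 : Set (Set (EuclideanSpace ℝ (Fin n))))
    (h𝒞 : ∀ C ∈ 𝒞, IsOpen C) (hcov : a ⊆ ⋃₀ 𝒞) :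
    ∃ (k : ℕ) (c : Fin k → EuclideanSpace ℝ (Fin n)) (r : Fin k → ℚ),
      (∀ j, 0 < r j) ∧
      (Pairwise fun j j' =>
        Disjoint (Metric.ball (c j) ((r j : ℝ))) (Metric.ball (c j') ((r j' : ℝ)))) ∧
      a ⊆ (⋃ j, Metric.ball (c j) ((r j : ℝ))) ∧
      (∀ j, ∃ C ∈ 𝒞, Metric.ball (c j) ((r j : ℝ)) ⊆ C) := by
  obtain ⟨f, hf⟩ := Set.countable_iff_exists_subset_range.1 ha
  choose T hT hST hcT using
    fun (S : {S // IsDisjointBallFamily a 𝒞 S}) => S.2.exists_superset ha h𝒞 hcov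
  let F : ℕ → {S // IsDisjointBallFamily a 𝒞 S} := fun m =>
    Nat.rec ⟨∅, by constructor <;> simp⟩ (fun m S => ⟨T S (f m), hT S (f m)⟩) m
  have hF : Monotone fun m => (F m).1 := monotone_nat_of_le_succ fun m => hST (F m) (f m)
  obtain ⟨N, hN⟩ := hac.elim_directed_cover
    (fun m => ⋃ p ∈ (F m).1, Metric.ball p.1 (p.2 : ℝ))
    (fun m => isOpen_biUnion fun _ _ => Metric.isOpen_ball)
    (fun x hx => by
      obtain ⟨m, rfl⟩ := hf hx
      exact Set.mem_iUnion.2 ⟨m + 1, hcT (F m) (f m) hx⟩)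
    (Monotone.directed_le fun i j hij => Set.biUnion_subset_biUnion_left (hF hij))
  have hG := (F N).2
  generalize (F N).1 = G at hN hG
  let e := G.equivFin.symm
  refine ⟨G.card, fun j => (e j).1.1, fun j => (e j).1.2, fun j => hG.pos _ (e j).2,
    fun i j hij => ?_, fun x hx => ?_, fun j => hG.subordinate _ (e j).2⟩
  · exact hG.pairwiseDisjoint (e i).2 (e j).2
      fun h => hij (e.injective (Subtype.ext h))
  · obtain ⟨p, hp, hxp⟩ := Set.mem_iUnion₂.1 (hN hx)
    refine Set.mem_iUnion.2 ⟨G.equivFin ⟨p, hp⟩, ?_⟩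
    simpa [e] using hxp
end

section
/- Let n ≥ 2 and let C_1, …, C_m (m ≥ 2) be pairwise disjoint closed metric balls of positive radius in ℝⁿ. Then there is a self-homeomorphism φ of ℝⁿ such that, setting K = φ '' (closed unit ball centered at the origin), one has C_1 ∪ C_2 ⊆ K and K ∩ C_i = ∅ for every i with 3 ≤ i ≤ m. -/
open Metric Set Filter Topology

section NormedSpace

variable {E : Type*} [NormedAddCommGroup E] [NormedSpace ℝ E]

/-- A radial rescaling whose factor is positive, monotone and bounded below is a homeomorphism. -/
theorem isHomeomorph_norm_smul [ProperSpace E] {k : ℝ → ℝ} (hk : Continuous k) (hmono : Monotone k)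
    {a : ℝ} (ha : 0 < a) (hak : ∀ t, a ≤ k t) : IsHomeomorph fun x : E ↦ k ‖x‖ • x := by
  have hpos (t : ℝ) : 0 < k t := ha.trans_le (hak t)
  have hstrict {s t : ℝ} (hs : 0 ≤ s) (hst : s < t) : k s * s < k t * t :=
    (mul_le_mul_of_nonneg_right (hmono hst.le) hs).trans_lt (mul_lt_mul_of_pos_left hst (hpos t))
  have hnorm (x : E) : ‖k ‖x‖ • x‖ = k ‖x‖ * ‖x‖ := by
    rw [norm_smul, Real.norm_of_nonneg (hpos _).le]
  have hcont : Continuous fun x : E ↦ k ‖x‖ • x := by fun_prop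
  rw [isHomeomorph_iff_continuous_isClosedMap_bijective]
  refine ⟨hcont, ?_, ?_, ?_⟩
  · refine (isProperMap_iff_tendsto_cocompact.2 ⟨hcont, ?_⟩).isClosedMap
    rw [← cobounded_eq_cocompact, ← tendsto_norm_atTop_iff_cobounded]
    refine tendsto_atTop_mono (fun x ↦ ?_) (tendsto_norm_cobounded_atTop.const_mul_atTop ha)
    rw [hnorm]
    exact mul_le_mul_of_nonneg_right (hak _) (norm_nonneg _)
  · intro x y hxy
    have h : k ‖x‖ * ‖x‖ = k ‖y‖ * ‖y‖ := by
      simpa only [hnorm] using congrArg norm hxy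
    have hxy' : ‖x‖ = ‖y‖ := by
      rcases lt_trichotomy ‖x‖ ‖y‖ with hlt | heq | hlt
      · exact absurd h (hstrict (norm_nonneg _) hlt).ne
      · exact heq
      · exact absurd h (hstrict (norm_nonneg _) hlt).ne'
    simp only [hxy'] at hxy
    exact smul_right_injective E (hpos _).ne' hxy
  · intro y
    rcases eq_or_ne y 0 with rfl | hy
    · exact ⟨0, by simp⟩
    have hy' : 0 < ‖y‖ := norm_pos_iff.2 hy
    obtain ⟨t, ht, hty⟩ : ‖y‖ ∈ (fun t ↦ k t * t) '' Icc 0 (‖y‖ / a) := by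
      refine intermediate_value_Icc (by positivity) (by fun_prop) ⟨by simp, ?_⟩
      calc ‖y‖ = a * (‖y‖ / a) := by field_simp
        _ ≤ _ := mul_le_mul_of_nonneg_right (hak _) (by positivity)
    refine ⟨(t / ‖y‖) • y, ?_⟩
    have hn : ‖(t / ‖y‖) • y‖ = t := by
      rw [norm_smul, Real.norm_of_nonneg (div_nonneg ht.1 hy'.le), div_mul_cancel₀ _ hy'.ne']
    simp only [hn, smul_smul]
    rw [← mul_div_assoc, show k t * t = ‖y‖ from hty, div_self hy'.ne', one_smul]

/-- A closed ball can be shrunk into any concentric ball by a homeomorphism which is the identity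
outside a slightly larger ball. -/
theorem exists_homeomorph_shrink_closedBall [ProperSpace E] (c : E) {r R ε : ℝ} (hr : 0 < r)
    (hrR : r < R) (hε : 0 < ε) : ∃ ψ : E ≃ₜ E,
      MapsTo ψ (closedBall c r) (closedBall c r ∩ ball c ε) ∧ ∀ x, R ≤ dist x c → ψ x = x := by
  obtain ⟨a, ha0, ha⟩ : ∃ a, 0 < a ∧ a < min 1 (ε / r) := exists_between (by positivity)
  have ha1 : a < 1 := ha.trans_le (min_le_left _ _)
  have har : a * r < ε := (lt_div_iff₀ hr).1 (ha.trans_le (min_le_right _ _))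
  have hRr : 0 < R - r := sub_pos.2 hrR
  set k : ℝ → ℝ := fun t ↦ a + (1 - a) * max 0 (min 1 ((t - r) / (R - r))) with hk
  have hkr {t : ℝ} (ht : t ≤ r) : k t = a := by
    have : (t - r) / (R - r) ≤ 0 := div_nonpos_of_nonpos_of_nonneg (sub_nonpos.2 ht) hRr.le
    simp [hk, max_eq_left ((min_le_right _ _).trans this)]
  have hkR {t : ℝ} (ht : R ≤ t) : k t = 1 := by
    have : 1 ≤ (t - r) / (R - r) := (one_le_div hRr).2 (by linarith)
    simp [hk, min_eq_left this]
  have hH := isHomeomorph_norm_smul (E := E) (k := k) (by fun_prop)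
    (fun s t hst ↦ by
      have : 0 ≤ 1 - a := by linarith
      simp only [hk]
      gcongr) ha0
    (fun t ↦ le_add_of_nonneg_right (mul_nonneg (by linarith) (le_max_left _ _)))
  refine ⟨((Homeomorph.subRight c).trans (hH.homeomorph _)).trans (Homeomorph.addRight c), ?_, ?_⟩
  · intro x hx
    rw [mem_closedBall, dist_eq_norm] at hx
    simp only [Homeomorph.trans_apply, Homeomorph.coe_addRight, IsHomeomorph.homeomorph_apply,
      Homeomorph.subRight_apply, hkr hx, mem_inter_iff, mem_closedBall, mem_ball, dist_eq_norm,
      add_sub_cancel_right, norm_smul, Real.norm_of_nonneg ha0.le]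
    have := mul_le_mul_of_nonneg_left hx ha0.le
    exact ⟨by nlinarith, by linarith⟩
  · intro x hx
    rw [dist_eq_norm] at hx
    simp [hkR hx]

/-- Finitely many pairwise disjoint closed balls can be shrunk simultaneously. -/
theorem exists_homeomorph_shrink_closedBalls [ProperSpace E] {ι : Type*} [Finite ι] (c : ι → E)
    (ρ : ι → ℝ) (hρ : ∀ i, 0 < ρ i)
    (hdisj : Pairwise fun i j ↦ Disjoint (closedBall (c i) (ρ i)) (closedBall (c j) (ρ j)))
    {ε : ℝ} (hε : 0 < ε) :
    ∃ ψ : E ≃ₜ E, ∀ i, MapsTo ψ (closedBall (c i) (ρ i)) (ball (c i) ε) := by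
  classical
  have := Fintype.ofFinite ι
  suffices h : ∀ s : Finset ι, ∃ ψ : E ≃ₜ E,
      (∀ i ∈ s, MapsTo ψ (closedBall (c i) (ρ i)) (ball (c i) ε)) ∧
      ∀ i ∉ s, ∀ x ∈ closedBall (c i) (ρ i), ψ x = x by
    obtain ⟨ψ, hψ, -⟩ := h Finset.univ
    exact ⟨ψ, fun i ↦ hψ i (Finset.mem_univ i)⟩
  intro s
  induction s using Finset.induction_on with
  | empty => exact ⟨Homeomorph.refl E, by simp, by simp⟩
  | insert k s hks ih =>
    obtain ⟨ψ, hψs, hψ⟩ := ih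
    obtain ⟨R, hR, hRj⟩ : ∃ R, ρ k < R ∧
        ∀ j, j ≠ k → ∀ x ∈ closedBall (c j) (ρ j), R ≤ dist x (c k) := by
      have hev : ∀ᶠ R in 𝓝[>] (ρ k), ∀ j, j ≠ k → R ≤ dist (c k) (c j) - ρ j := by
        refine eventually_all.2 fun j ↦ ?_
        by_cases hj : j = k
        · simp [hj]
        have hlt := (disjoint_closedBall_closedBall_iff (hρ k).le (hρ j).le).1 (hdisj (Ne.symm hj))
        filter_upwards [Ioo_mem_nhdsGT (lt_sub_iff_add_lt.2 hlt)] with R hR' _ using hR'.2.le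
      obtain ⟨R, hR, hRk⟩ := (hev.and self_mem_nhdsWithin).exists
      refine ⟨R, hRk, fun j hj x hx ↦ ?_⟩
      have := hR j hj
      have := dist_triangle (c k) x (c j)
      rw [mem_closedBall] at hx
      rw [dist_comm x (c k)]
      linarith
    obtain ⟨θ, hθ, hθ'⟩ := exists_homeomorph_shrink_closedBall (c k) (hρ k) hR hε
    refine ⟨θ.trans ψ, fun i hi x hx ↦ ?_, fun i hi x hx ↦ ?_⟩
    · rw [Homeomorph.trans_apply]
      by_cases hik : i = k
      · subst hik
        rw [hψ i hks _ (hθ hx).1]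
        exact (hθ hx).2
      · rw [hθ' x (hRj i hik x hx)]
        exact hψs i (Finset.mem_of_mem_insert_of_ne hi hik) hx
    · rw [Finset.mem_insert, not_or] at hi
      rw [Homeomorph.trans_apply, hθ' x (hRj i hi.1 x hx), hψ i hi.2 x hx]

end NormedSpace

section InnerProductSpace

variable {E : Type*} [NormedAddCommGroup E] [InnerProductSpace ℝ E]

/-- The shear in the direction `w` whose amount is a continuous function of the inner product with
a vector orthogonal to `w`. -/
def Homeomorph.innerShear (u w : E) (huw : inner ℝ u w = 0) (h : ℝ → ℝ) (hh : Continuous h) :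
    E ≃ₜ E where
  toFun x := x + h (inner ℝ u x) • w
  invFun x := x - h (inner ℝ u x) • w
  left_inv x := by simp [inner_add_right, inner_smul_right, huw]
  right_inv x := by simp [inner_sub_right, inner_smul_right, huw]
  continuous_toFun := by fun_prop
  continuous_invFun := by fun_prop

theorem exists_ne_zero_inner_eq_zero [FiniteDimensional ℝ E] (hE : 2 ≤ Module.finrank ℝ E) (u : E) :
    ∃ w : E, w ≠ 0 ∧ inner ℝ u w = 0 := by
  have h1 := Submodule.finrank_add_finrank_orthogonal (ℝ ∙ u)
  have h2 := finrank_span_le_card (R := ℝ) ({u} : Set E)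
  rw [toFinset_singleton, Finset.card_singleton] at h2
  have h3 : (ℝ ∙ u)ᗮ ≠ ⊥ := by
    intro h
    rw [h, finrank_bot] at h1
    omega
  obtain ⟨w, hw, hw0⟩ := Submodule.exists_mem_ne_zero_of_ne_bot h3
  exact ⟨w, hw0, Submodule.mem_orthogonal_singleton_iff_inner_right.1 hw⟩

/-- In dimension at least two, a homeomorphism fixing `a` and `b` moves any finite set avoiding
`a` and `b` off the segment joining them. -/
theorem exists_homeomorph_notMem_segment [FiniteDimensional ℝ E] (hE : 2 ≤ Module.finrank ℝ E)
    {a b : E} (hab : a ≠ b) {F : Set E} (hF : F.Finite) (haF : a ∉ F) (hbF : b ∉ F) :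
    ∃ P : E ≃ₜ E, P a = a ∧ P b = b ∧ ∀ x ∈ F, P x ∉ segment ℝ a b := by
  obtain ⟨w, hw0, hw⟩ := exists_ne_zero_inner_eq_zero hE (b - a)
  set u := b - a with hu
  have hu0 : inner ℝ u u ≠ 0 := inner_self_ne_zero.2 (sub_ne_zero.2 hab.symm)
  set h : ℝ → ℝ := fun t ↦ (t - inner ℝ u a) * (t - inner ℝ u b) with hh
  let P (s : ℝ) : E ≃ₜ E := Homeomorph.innerShear u w hw (fun t ↦ s * h t) (by fun_prop)
  have hP (s : ℝ) (x : E) : P s x = x + (s * h (inner ℝ u x)) • w := rfl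
  have hbad : (⋃ x ∈ F, {s | P s x ∈ segment ℝ a b}).Finite := by
    refine hF.biUnion fun x hx ↦ Set.Subsingleton.finite fun s hs s' hs' ↦ ?_
    rw [mem_ofPred_eq, segment_eq_image'] at hs hs'
    obtain ⟨l, -, hl⟩ := hs
    obtain ⟨l', -, hl'⟩ := hs'
    simp only [hP, ← hu] at hl hl'
    have hi : inner ℝ u a + l * inner ℝ u u = inner ℝ u x := by
      simpa [inner_add_right, inner_smul_right, hw] using congrArg (inner ℝ u) hl
    have hi' : inner ℝ u a + l' * inner ℝ u u = inner ℝ u x := by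
      simpa [inner_add_right, inner_smul_right, hw] using congrArg (inner ℝ u) hl'
    obtain rfl : l = l' := mul_right_cancel₀ hu0 (by linarith)
    have hsw := smul_left_injective ℝ hw0 (add_left_cancel (hl.symm.trans hl'))
    refine mul_right_cancel₀ (fun h0 ↦ ?_) hsw
    rw [h0, mul_zero, zero_smul, add_zero] at hl
    have hub : inner ℝ u b = inner ℝ u a + inner ℝ u u := by
      rw [← inner_add_right, hu, add_sub_cancel]
    have hll : (l * inner ℝ u u) * ((l - 1) * inner ℝ u u) = 0 := by
      rw [← h0]
      simp only [hh]
      rw [hub, ← hi]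
      ring
    simp only [mul_eq_zero, hu0, or_false] at hll
    rcases hll with rfl | hl1
    · exact haF (by simpa [← hl] using hx)
    · rw [sub_eq_zero.1 hl1, one_smul, hu, add_sub_cancel] at hl
      exact hbF (hl ▸ hx)
  obtain ⟨s, hs⟩ := hbad.exists_notMem
  refine ⟨P s, by simp [hP, hh], by simp [hP, hh], fun x hx hxs ↦ hs ?_⟩
  exact mem_biUnion hx hxs

/-- In dimension at least two, a topological ball can engulf two members of a finite family of
disjoint closed balls while avoiding the other ones. -/
theorem exists_homeomorph_image_closedBall_engulf [FiniteDimensional ℝ E]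
    (hE : 2 ≤ Module.finrank ℝ E) {ι : Type*} [Finite ι] (c : ι → E) (ρ : ι → ℝ)
    (hρ : ∀ i, 0 < ρ i)
    (hdisj : Pairwise fun i j ↦ Disjoint (closedBall (c i) (ρ i)) (closedBall (c j) (ρ j)))
    {p q : ι} (hpq : p ≠ q) :
    ∃ φ : E ≃ₜ E, closedBall (c p) (ρ p) ⊆ φ '' closedBall 0 1 ∧
      closedBall (c q) (ρ q) ⊆ φ '' closedBall 0 1 ∧
      ∀ i, i ≠ p → i ≠ q → Disjoint (φ '' closedBall 0 1) (closedBall (c i) (ρ i)) := by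
  have : ProperSpace E := FiniteDimensional.proper ℝ E
  have hinj : Function.Injective c := fun i j hij ↦ by
    by_contra hne
    refine disjoint_left.1 (hdisj hne) (mem_closedBall_self (hρ i).le) ?_
    rw [hij]
    exact mem_closedBall_self (hρ j).le
  obtain ⟨P, hPp, hPq, hP⟩ := exists_homeomorph_notMem_segment hE (hinj.ne hpq)
    (F := c '' {i | i ≠ p ∧ i ≠ q}) (Set.toFinite _)
    (by rw [hinj.mem_set_image]; simp) (by rw [hinj.mem_set_image]; simp)
  set S := segment ℝ (c p) (c q) with hS
  have hSc : IsCompact S := by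
    rw [hS, segment_eq_image']
    exact isCompact_Icc.image (by fun_prop)
  obtain ⟨η, hη, hηS⟩ : ∃ η > 0, ∀ i, i ≠ p → i ≠ q → P (c i) ∉ cthickening η S := by
    have hdis : Disjoint S (P '' (c '' {i | i ≠ p ∧ i ≠ q})) := by
      rw [disjoint_right]
      rintro _ ⟨x, hx, rfl⟩
      exact hP x hx
    obtain ⟨η, hη, h⟩ := hdis.exists_cthickenings hSc (Set.toFinite _).isClosed
    exact ⟨η, hη, fun i hip hiq hi ↦ disjoint_left.1 h hi
      (self_subset_cthickening _ ⟨_, ⟨i, ⟨hip, hiq⟩, rfl⟩, rfl⟩)⟩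
  have hSK : thickening η S ⊆ cthickening η S := thickening_subset_cthickening _ _
  have hint : (interior (cthickening η S)).Nonempty :=
    ⟨c p, thickening_subset_interior_cthickening _ _
      (self_subset_thickening hη _ (left_mem_segment ℝ _ _))⟩
  obtain ⟨Q, -, hQ, -⟩ := exists_homeomorph_image_interior_closure_frontier_eq_unitBall
    ((convex_segment (𝕜 := ℝ) (c p) (c q)).cthickening η) hint hSc.isBounded.cthickening
  rw [isClosed_cthickening.closure_eq] at hQ
  have hQ' : Q.symm '' closedBall 0 1 = cthickening η S := by
    rw [← hQ, ← image_comp]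
    simp [hS]
  have hnear (i : ι) {U : Set E} (hU : IsOpen U) (hi : P (c i) ∈ U) :
      ∀ᶠ ε in 𝓝[>] (0 : ℝ), MapsTo P (ball (c i) ε) U :=
    (eventually_ball_subset (P.continuous.continuousAt.preimage_mem_nhds
      (hU.mem_nhds hi))).filter_mono nhdsWithin_le_nhds
  obtain ⟨ε, ⟨⟨hεp, hεq⟩, hεi⟩, hε⟩ : ∃ ε : ℝ, ((MapsTo P (ball (c p) ε) (thickening η S) ∧
      MapsTo P (ball (c q) ε) (thickening η S)) ∧
      ∀ i, i ≠ p → i ≠ q → MapsTo P (ball (c i) ε) (cthickening η S)ᶜ) ∧ 0 < ε := by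
    refine ((((hnear p isOpen_thickening ?_).and (hnear q isOpen_thickening ?_)).and
      (eventually_all.2 fun i ↦ ?_)).and self_mem_nhdsWithin).exists
    · rw [hPp]
      exact self_subset_thickening hη _ (left_mem_segment ℝ _ _)
    · rw [hPq]
      exact self_subset_thickening hη _ (right_mem_segment ℝ _ _)
    · by_cases hi : i ≠ p ∧ i ≠ q
      · filter_upwards [hnear i isClosed_cthickening.isOpen_compl (hηS i hi.1 hi.2)]
          with ε hε _ _ using hε
      · exact Eventually.of_forall fun ε hip hiq ↦ absurd ⟨hip, hiq⟩ hi
  obtain ⟨ψ, hψ⟩ := exists_homeomorph_shrink_closedBalls c ρ hρ hdisj hε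
  have hφ : (Q.symm.trans (ψ.trans P).symm) '' closedBall 0 1 = (ψ.trans P) ⁻¹' cthickening η S := by
    rw [← hQ', ← Homeomorph.image_symm, ← image_comp]
    rfl
  refine ⟨Q.symm.trans (ψ.trans P).symm, ?_⟩
  rw [hφ]
  exact ⟨fun x hx ↦ hSK (hεp (hψ p hx)), fun x hx ↦ hSK (hεq (hψ q hx)),
    fun i hip hiq ↦ disjoint_right.2 fun x hx ↦ hεi i hip hiq (hψ i hx)⟩

end InnerProductSpace

/-- Given pairwise disjoint closed balls in ℝⁿ (n ≥ 2), there is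
a homeomorphic image of the closed unit ball containing the first two balls
and disjoint from all the others. -/
theorem stmt8 (n : ℕ) (hn : 2 ≤ n) (m : ℕ) (hm : 2 ≤ m)
    (c : Fin m → EuclideanSpace ℝ (Fin n)) (ρ : Fin m → ℝ)
    (hρ : ∀ i, 0 < ρ i)
    (hdisj : Pairwise fun i j =>
      Disjoint (Metric.closedBall (c i) (ρ i)) (Metric.closedBall (c j) (ρ j))) :
    ∃ φ : EuclideanSpace ℝ (Fin n) ≃ₜ EuclideanSpace ℝ (Fin n),
      Metric.closedBall (c ⟨0, by omega⟩) (ρ ⟨0, by omega⟩) ⊆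
        φ '' Metric.closedBall 0 1 ∧
      Metric.closedBall (c ⟨1, by omega⟩) (ρ ⟨1, by omega⟩) ⊆
        φ '' Metric.closedBall 0 1 ∧
      ∀ i : Fin m, 2 ≤ (i : ℕ) →
        Disjoint (φ '' Metric.closedBall 0 1) (Metric.closedBall (c i) (ρ i)) := by
  obtain ⟨φ, hp, hq, h⟩ := exists_homeomorph_image_closedBall_engulf (by simpa using hn) c ρ hρ
    hdisj (p := ⟨0, by omega⟩) (q := ⟨1, by omega⟩) (by simp)
  refine ⟨φ, hp, hq, fun i hi ↦ h i ?_ ?_⟩ <;>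
  · rintro rfl
    simp at hi
end

section
/- Let n ≥ 1, let a be a nonempty countable compact subset of ℝⁿ, let b be a countable compact subset of ℝⁿ, and let ε > 0. Then there is a self-homeomorphism h of ℝⁿ with compact support (i.e., {x : h x ≠ x} has compact closure) such that h x = x for all x ∈ a and h '' b ⊆ {x : dist(x, a) < ε}. -/
open Set Filter Topology

/-- A `1`-Lipschitz cutoff, positive exactly at the points of the open ball of radius `R` around `p`
whose distance to `a` exceeds `δ`. -/
noncomputable def cutoff {E : Type*} [PseudoMetricSpace E] (a : Set E) (p : E) (δ R : ℝ) (x : E) :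
    ℝ :=
  max 0 (min (Metric.infDist x a - δ) (R - dist x p))

section Cutoff

variable {E : Type*} [PseudoMetricSpace E] {a : Set E} {p : E} {δ R : ℝ}

lemma cutoff_nonneg (x : E) : 0 ≤ cutoff a p δ R x := le_max_left _ _

lemma abs_cutoff_sub_le (x y : E) : |cutoff a p δ R x - cutoff a p δ R y| ≤ dist x y := by
  have h₁ : |(Metric.infDist x a - δ) - (Metric.infDist y a - δ)| ≤ dist x y := by
    simpa [Real.dist_eq] using (Metric.lipschitz_infDist_pt a).dist_le_mul x y
  have h₂ : |(R - dist x p) - (R - dist y p)| ≤ dist x y := by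
    rw [sub_sub_sub_cancel_left, abs_sub_comm]
    exact abs_dist_sub_le x y p
  have h₃ := abs_max_sub_max_le_max 0 (min (Metric.infDist x a - δ) (R - dist x p)) 0
    (min (Metric.infDist y a - δ) (R - dist y p))
  have h₄ := abs_min_sub_min_le_max (Metric.infDist x a - δ) (R - dist x p)
    (Metric.infDist y a - δ) (R - dist y p)
  refine h₃.trans (max_le ?_ (h₄.trans (max_le h₁ h₂)))
  simp

lemma continuous_cutoff : Continuous (cutoff a p δ R) := by
  unfold cutoff
  have := Metric.continuous_infDist_pt a
  fun_prop

lemma cutoff_eq_zero_of_infDist_le {x : E} (h : Metric.infDist x a ≤ δ) :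
    cutoff a p δ R x = 0 :=
  max_eq_left ((min_le_left _ _).trans (by linarith))

lemma cutoff_eq_zero_of_le_dist {x : E} (h : R ≤ dist x p) : cutoff a p δ R x = 0 :=
  max_eq_left ((min_le_right _ _).trans (by linarith))

lemma cutoff_pos {x : E} (h : δ < Metric.infDist x a) (h' : dist x p < R) :
    0 < cutoff a p δ R x :=
  lt_max_of_lt_right (lt_min (by linarith) (by linarith))

lemma cutoff_le (hR : 0 ≤ R) (x : E) : cutoff a p δ R x ≤ R :=
  max_le hR ((min_le_right _ _).trans (by linarith [dist_nonneg (x := x) (y := p)]))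

end Cutoff

section Contraction

variable {E : Type*} [NormedAddCommGroup E] [NormedSpace ℝ E] {a : Set E} {p : E} {δ R : ℝ}

lemma norm_cutoff_smul_sub_le (hR : 0 ≤ R) (x y : E) :
    ‖cutoff a p δ R x • (p - x) - cutoff a p δ R y • (p - y)‖ ≤ 2 * R * ‖x - y‖ := by
  wlog hy : dist y p ≤ R generalizing x y
  · rcases le_total (dist x p) R with hx | hx
    · rw [norm_sub_rev, norm_sub_rev x]
      exact this y x hx
    · rw [cutoff_eq_zero_of_le_dist hx, cutoff_eq_zero_of_le_dist (not_le.1 hy).le]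
      simp only [zero_smul, sub_self, norm_zero]
      positivity
  have key : cutoff a p δ R x • (p - x) - cutoff a p δ R y • (p - y) =
      cutoff a p δ R x • (y - x) + (cutoff a p δ R x - cutoff a p δ R y) • (p - y) := by
    module
  rw [key]
  refine (norm_add_le _ _).trans ?_
  rw [norm_smul, norm_smul, Real.norm_eq_abs, Real.norm_eq_abs, abs_of_nonneg (cutoff_nonneg x),
    norm_sub_rev y x, ← dist_eq_norm p y, dist_comm p y]
  have h₁ := mul_le_mul_of_nonneg_right (cutoff_le (a := a) (p := p) (δ := δ) hR x)
    (norm_nonneg (x - y))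
  have h₂ := mul_le_mul (abs_cutoff_sub_le (a := a) (p := p) (δ := δ) (R := R) x y) hy
    dist_nonneg dist_nonneg
  rw [dist_eq_norm x y] at h₂
  linarith

/-- Moving each point towards `p` by a small multiple of the cutoff is a homeomorphism. -/
lemma exists_homeomorph_eq_lineMap_cutoff [CompleteSpace E] (a : Set E) (p : E) (δ : ℝ)
    (hR : 0 < R) :
    ∃ g : E ≃ₜ E, ∀ x, g x = AffineMap.lineMap x p (cutoff a p δ R x / (4 * R)) := by
  let f : E → E := fun x ↦ AffineMap.lineMap x p (cutoff a p δ R x / (4 * R))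
  have hf : ApproximatesLinearOn f (ContinuousLinearEquiv.refl ℝ E : E →L[ℝ] E) univ (1 / 2) := by
    intro x _ y _
    have key : f x - f y - (x - y) =
        (4 * R)⁻¹ • (cutoff a p δ R x • (p - x) - cutoff a p δ R y • (p - y)) := by
      simp only [f, AffineMap.lineMap_apply_module', div_eq_inv_mul]
      module
    simp only [ContinuousLinearEquiv.coe_coe, ContinuousLinearEquiv.coe_refl', id]
    rw [key, norm_smul, Real.norm_of_nonneg (by positivity)]
    have := mul_le_mul_of_nonneg_left
      (norm_cutoff_smul_sub_le (a := a) (p := p) (δ := δ) hR.le x y)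
      (show 0 ≤ (4 * R)⁻¹ by positivity)
    refine this.trans (le_of_eq ?_)
    push_cast
    field_simp
    norm_num
  refine ⟨hf.toHomeomorph f ?_, fun x ↦ rfl⟩
  rcases subsingleton_or_nontrivial E with h | h
  · exact Or.inl h
  · right
    have : ‖((ContinuousLinearEquiv.refl ℝ E).symm : E →L[ℝ] E)‖₊ = 1 := by
      ext
      exact ContinuousLinearMap.norm_id
    rw [this, inv_one]
    exact NNReal.half_lt_self one_ne_zero

end Contraction

lemma Homeomorph.exists_coe_eq_iterate {X : Type*} [TopologicalSpace X] (g : X ≃ₜ X) (k : ℕ) :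
    ∃ h : X ≃ₜ X, ⇑h = g^[k] := by
  induction k with
  | zero => exact ⟨Homeomorph.refl X, rfl⟩
  | succ k ih =>
    obtain ⟨h, hh⟩ := ih
    exact ⟨g.trans h, by rw [Function.iterate_succ, ← hh]; rfl⟩

/-- Orbits of `s ↦ s + (1 - s) * f s` starting at `0` reach `[s₁, s₂]` in a time depending only on
`s₁` and a lower bound `m` of `f` on `[0, s₁]`. -/
lemma iterate_mem_Icc_of_le {f : ℝ → ℝ} {s₁ s₂ m : ℝ} (h0 : 0 ≤ s₁) (h12 : s₁ < s₂) (h2 : s₂ ≤ 1)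
    (hm : 0 < m) (hf₁ : ∀ s ∈ Icc 0 s₁, m ≤ f s) (hf₂ : ∀ s ∈ Icc 0 s₂, 0 ≤ f s ∧ f s ≤ s₂ - s)
    {k : ℕ} (hk : 1 ≤ k * ((1 - s₁) * m)) :
    (fun s ↦ s + (1 - s) * f s)^[k] 0 ∈ Icc s₁ s₂ := by
  have key : ∀ k : ℕ, (fun s ↦ s + (1 - s) * f s)^[k] 0 ∈ Icc 0 s₂ ∧
      min s₁ (k * ((1 - s₁) * m)) ≤ (fun s ↦ s + (1 - s) * f s)^[k] 0 := by
    intro k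
    induction k with
    | zero => simp [h0.trans h12.le, h0]
    | succ k ih =>
      rw [Function.iterate_succ_apply']
      set s := (fun s ↦ s + (1 - s) * f s)^[k] 0
      obtain ⟨hs, hmin⟩ := ih
      obtain ⟨hf0, hfs⟩ := hf₂ s hs
      have hs1 : 0 ≤ 1 - s := by linarith [hs.2]
      refine ⟨⟨by nlinarith [hs.1], by nlinarith [hs.1]⟩, ?_⟩
      rcases le_total s₁ s with h | h
      · exact (min_le_left _ _).trans (by nlinarith)
      · have hms := hf₁ s ⟨hs.1, h⟩
        have hstep : (1 - s₁) * m ≤ (1 - s) * f s :=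
          mul_le_mul (by linarith) hms hm.le hs1
        push_cast
        rcases min_le_iff.1 hmin with h' | h'
        · refine (min_le_left _ _).trans ?_
          nlinarith
        · exact (min_le_right _ _).trans (by linarith)
  refine ⟨?_, (key k).1.2⟩
  have := (key k).2
  rwa [min_eq_left (by linarith)] at this

/-- A continuous function that starts above `δ` and ends below it drops strictly below `δ` right
after first reaching it, provided `δ` is not a local minimum value. -/
lemma exists_first_crossing {f : ℝ → ℝ} (hf : Continuous f) {δ ε : ℝ} (hδε : δ < ε) (h0 : δ < f 0)
    (h1 : f 1 < δ) (hδ : ∀ q r : ℚ, δ ≠ sInf (f '' Ioo (q : ℝ) r)) :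
    ∃ s₁ s₂ : ℝ, 0 ≤ s₁ ∧ s₁ < s₂ ∧ s₂ ≤ 1 ∧ (∀ s ∈ Icc 0 s₁, δ < f s) ∧
      (∀ s ∈ Icc s₁ s₂, f s < ε) ∧ f s₂ < δ := by
  let S : Set ℝ := Icc 0 1 ∩ f ⁻¹' Iic δ
  have hScomp : IsCompact S := isCompact_Icc.inter_right (isClosed_Iic.preimage hf)
  obtain ⟨t, ⟨ht, htδ⟩, hmin⟩ := hScomp.exists_isLeast ⟨1, ⟨by simp, h1.le⟩⟩
  replace htδ : f t ≤ δ := htδ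
  have hbefore : ∀ s, 0 ≤ s → s < t → δ < f s := fun s hs hst ↦ by
    by_contra! h
    exact absurd (hmin ⟨⟨hs, hst.le.trans ht.2⟩, h⟩) (not_le.2 hst)
  have ht0 : 0 < t := ht.1.lt_of_ne (by rintro rfl; linarith)
  have hft : f t = δ := by
    refine htδ.antisymm (ge_of_tendsto (hf.continuousAt.mono_left nhdsWithin_le_nhds :
      Tendsto f (𝓝[<] t) (𝓝 (f t))) ?_)
    filter_upwards [Ioo_mem_nhdsLT ht0] with s hs using (hbefore s hs.1.le hs.2).le
  have ht1 : t < 1 := ht.2.lt_of_ne (by rintro rfl; linarith)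
  obtain ⟨η, hη, hball⟩ := Metric.eventually_nhds_iff.1
    (hf.continuousAt.eventually_lt_const (hft.trans_lt hδε))
  obtain ⟨s₂, hts, hs₂, hfs₂⟩ : ∃ s₂, t < s₂ ∧ s₂ < min 1 (t + η) ∧ f s₂ < δ := by
    by_contra! h
    obtain ⟨q, hq0, hqt⟩ := exists_rat_btwn ht0
    obtain ⟨r, htr, hr⟩ := exists_rat_btwn (lt_min ht1 (lt_add_of_pos_right t hη))
    suffices hleast : IsLeast (f '' Ioo (q : ℝ) r) δ from hδ q r hleast.csInf_eq.symm
    refine ⟨⟨t, ⟨hqt, htr⟩, hft⟩, ?_⟩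
    rintro _ ⟨s, hs, rfl⟩
    rcases lt_trichotomy s t with hst | rfl | hst
    · exact (hbefore s (hq0.le.trans hs.1.le) hst).le
    · exact hft.ge
    · exact h s hst (hs.2.trans hr)
  have hmax : max 0 (t - η) < t := max_lt ht0 (by linarith)
  obtain ⟨s₁, hs₁, hs₁t⟩ := exists_between hmax
  obtain ⟨h01, hη1⟩ := max_lt_iff.1 hs₁
  obtain ⟨h21, hη2⟩ := lt_min_iff.1 hs₂
  refine ⟨s₁, s₂, h01.le, hs₁t.trans hts, h21.le,
    fun s hs ↦ hbefore s hs.1 (hs.2.trans_lt hs₁t), fun s hs ↦ hball ?_, hfs₂⟩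
  rw [Real.dist_eq, abs_lt]
  constructor <;> linarith [hs.1, hs.2]

section Orbits

variable {E : Type*} [NormedAddCommGroup E] [NormedSpace ℝ E] {a : Set E} {p : E} {δ ε R : ℝ}

lemma iterate_eq_lineMap {g : E → E} {ρ : E → ℝ} (hg : ∀ x, g x = AffineMap.lineMap x p (ρ x))
    (y : E) (k : ℕ) :
    g^[k] y = AffineMap.lineMap y p
      ((fun s ↦ s + (1 - s) * ρ (AffineMap.lineMap y p s))^[k] 0) := by
  induction k with
  | zero => simp
  | succ k ih =>
    rw [Function.iterate_succ_apply', Function.iterate_succ_apply', ih, hg]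
    simp only [AffineMap.lineMap_apply_module']
    module

lemma eventually_infDist_iterate_lt {g : E → E}
    (hg : ∀ x, g x = AffineMap.lineMap x p (cutoff a p δ R x / (4 * R))) (hp : p ∈ a)
    (hδ : 0 < δ) (hδε : δ < ε) {x : E} (hxR : dist x p < R) (hxδ : δ ≠ Metric.infDist x a)
    (hx : ∀ q r : ℚ, δ ≠
      sInf ((fun s : ℝ ↦ Metric.infDist (AffineMap.lineMap x p s) a) '' Ioo (q : ℝ) r)) :
    ∃ N ∈ 𝓝 x, ∀ᶠ k in atTop, ∀ y ∈ N, Metric.infDist (g^[k] y) a < ε := by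
  have hR : 0 < R := dist_nonneg.trans_lt hxR
  have hdist := Metric.continuous_infDist_pt a
  rcases hxδ.lt_or_gt with hlt | hlt
  · have hline : Continuous fun z : E × ℝ ↦ (AffineMap.lineMap z.1 p z.2 : E) := by
      simp only [AffineMap.lineMap_apply_module']
      fun_prop
    have hlinex : Continuous fun s : ℝ ↦ (AffineMap.lineMap x p s : E) := by
      simp only [AffineMap.lineMap_apply_module']
      fun_prop
    obtain ⟨s₁, s₂, h0, h12, h2, hs₁, hs₁₂, hs₂⟩ := exists_first_crossing
      (hdist.comp hlinex) hδε (by simpa using hlt)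
      (by simpa [Metric.infDist_zero_of_mem hp] using hδ) hx
    have hdl : ∀ y : E, ∀ s ∈ Icc (0 : ℝ) 1, dist (AffineMap.lineMap y p s) p ≤ dist y p := by
      intro y s hs
      rw [dist_lineMap_right, Real.norm_of_nonneg (by linarith [hs.2])]
      exact mul_le_of_le_one_left dist_nonneg (by linarith [hs.1])
    obtain ⟨t, ht, htmin⟩ := (isCompact_Icc (a := (0 : ℝ)) (b := s₁)).exists_isMinOn
      ⟨0, by simp [h0]⟩
      ((continuous_cutoff (a := a) (p := p) (δ := δ) (R := R)).comp hlinex).continuousOn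
    set M := cutoff a p δ R (AffineMap.lineMap x p t) with hM
    have hMpos : 0 < M := cutoff_pos (hs₁ t ht)
      ((hdl x t ⟨ht.1, by linarith [ht.2]⟩).trans_lt hxR)
    have e₁ : ∀ᶠ y in 𝓝 x, ∀ s ∈ Icc 0 s₁, M / 2 < cutoff a p δ R (AffineMap.lineMap y p s) := by
      refine isCompact_Icc.eventually_forall_of_forall_eventually fun s hs ↦ ?_
      refine (continuous_cutoff.comp hline).continuousAt.eventually_const_lt ?_
      exact (half_lt_self hMpos).trans_le (htmin hs)
    have e₂ : ∀ᶠ y in 𝓝 x, ∀ s ∈ Icc s₁ s₂, Metric.infDist (AffineMap.lineMap y p s) a < ε := by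
      refine isCompact_Icc.eventually_forall_of_forall_eventually fun s hs ↦ ?_
      exact (hdist.comp hline).continuousAt.eventually_lt_const (hs₁₂ s hs)
    have e₃ : ∀ᶠ y in 𝓝 x, Metric.infDist (AffineMap.lineMap y p s₂) a < δ :=
      (hdist.comp (hline.comp (Continuous.prodMk_left s₂))).continuousAt.eventually_lt_const hs₂
    have e₄ : ∀ᶠ y in 𝓝 x, dist y p < R :=
      (continuous_id.dist continuous_const).continuousAt.eventually_lt_const hxR
    refine ⟨_, e₁.and (e₂.and (e₃.and e₄)), ?_⟩
    have hm : 0 < M / 2 / (4 * R) := by positivity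
    have hc : 0 < (1 - s₁) * (M / 2 / (4 * R)) := mul_pos (by linarith) hm
    filter_upwards [(tendsto_natCast_atTop_atTop.atTop_mul_const hc).eventually_ge_atTop 1]
      with k hk y ⟨hy₁, hy₂, hy₃, hy₄⟩
    rw [iterate_eq_lineMap (ρ := fun z ↦ cutoff a p δ R z / (4 * R)) hg]
    refine hy₂ _ (iterate_mem_Icc_of_le h0 h12 h2 hm (fun s hs ↦ ?_) (fun s hs ↦ ⟨?_, ?_⟩) hk)
    · exact div_le_div_of_nonneg_right (hy₁ s hs).le (by positivity)
    · exact div_nonneg (cutoff_nonneg _) (by positivity)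
    · have h := abs_cutoff_sub_le (a := a) (p := p) (δ := δ) (R := R)
        (AffineMap.lineMap y p s) (AffineMap.lineMap y p s₂)
      rw [cutoff_eq_zero_of_infDist_le hy₃.le, sub_zero, abs_of_nonneg (cutoff_nonneg _),
        dist_lineMap_lineMap, dist_comm, Real.dist_eq, abs_of_nonneg (by linarith [hs.2])] at h
      rw [div_le_iff₀ (by positivity)]
      nlinarith [hs.2, mul_le_mul_of_nonneg_left hy₄.le (sub_nonneg.2 hs.2),
        mul_nonneg (sub_nonneg.2 hs.2) hR.le]
  · refine ⟨_, hdist.continuousAt.eventually_lt_const hlt, Eventually.of_forall fun k y hy ↦ ?_⟩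
    replace hy : Metric.infDist y a < δ := hy
    have hgy : Function.IsFixedPt g y := by
      rw [Function.IsFixedPt, hg, cutoff_eq_zero_of_infDist_le hy.le]
      simp
    rw [hgy.iterate k]
    exact hy.trans hδε

end Orbits

/-- Tightness of ℝⁿ with the ideal generated by countable compact
sets, witnessed by a compactly supported homeomorphism. -/
theorem stmt9 (n : ℕ) (hn : 1 ≤ n)
    (a b : Set (EuclideanSpace ℝ (Fin n)))
    (hane : a.Nonempty) (ha : a.Countable) (hac : IsCompact a)
    (hb : b.Countable) (hbc : IsCompact b)
    (ε : ℝ) (hε : 0 < ε) :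
    ∃ h : EuclideanSpace ℝ (Fin n) ≃ₜ EuclideanSpace ℝ (Fin n),
      IsCompact (closure {x | h x ≠ x}) ∧
      (∀ x ∈ a, h x = x) ∧
      h '' b ⊆ Metric.thickening ε a := by
  obtain ⟨p, hp⟩ := hane
  obtain ⟨R, hR, hbR⟩ := hbc.isBounded.subset_ball_lt 0 p
  let bad : Set ℝ := (fun x ↦ Metric.infDist x a) '' b ∪ ⋃ x ∈ b, ⋃ q : ℚ, ⋃ r : ℚ,
    {sInf ((fun s : ℝ ↦ Metric.infDist (AffineMap.lineMap x p s) a) '' Ioo (q : ℝ) r)}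
  have hbad : bad.Countable := (hb.image _).union <| hb.biUnion fun x _ ↦
    countable_iUnion fun q ↦ countable_iUnion fun r ↦ countable_singleton _
  obtain ⟨δ, hδbad, hδ, hδε⟩ := (hbad.dense_compl ℝ).exists_between hε
  simp only [bad, mem_compl_iff, mem_union, mem_image, mem_iUnion, mem_singleton_iff, not_or,
    not_exists, not_and] at hδbad
  obtain ⟨hδ₁, hδ₂⟩ := hδbad
  obtain ⟨g, hg⟩ := exists_homeomorph_eq_lineMap_cutoff a p δ hR
  have hfix : ∀ {x}, cutoff a p δ R x = 0 → ∀ k, g^[k] x = x := fun {x} hx k ↦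
    Function.IsFixedPt.iterate (by rw [Function.IsFixedPt, hg, hx]; simp) k
  have hev : ∀ᶠ k in atTop, ∀ y ∈ b, Metric.infDist (g^[k] y) a < ε := by
    refine hbc.induction_on (p := fun s ↦ ∀ᶠ k in atTop, ∀ y ∈ s, Metric.infDist (g^[k] y) a < ε)
      (by simp) (fun s t hst ht ↦ ht.mono fun k hk y hy ↦ hk y (hst hy))
      (fun s t hs ht ↦ ?_) fun x hx ↦ ?_
    · filter_upwards [hs, ht] with k h₁ h₂ y hy using hy.elim (h₁ y) (h₂ y)
    · obtain ⟨N, hN, h⟩ := eventually_infDist_iterate_lt hg hp hδ hδε (hbR hx)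
        (fun h ↦ hδ₁ x hx h.symm) (hδ₂ x hx)
      exact ⟨N, mem_nhdsWithin_of_mem_nhds hN, h⟩
  obtain ⟨k, hk⟩ := hev.exists
  obtain ⟨h, hh⟩ := g.exists_coe_eq_iterate k
  refine ⟨h, ?_, fun x hx ↦ ?_, ?_⟩
  · refine (isCompact_closedBall p R).of_isClosed_subset isClosed_closure
      (closure_minimal (fun x hx ↦ ?_) Metric.isClosed_closedBall)
    by_contra hxR
    rw [Metric.mem_closedBall, not_le] at hxR
    exact hx (by rw [hh]; exact hfix (cutoff_eq_zero_of_le_dist hxR.le) k)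
  · rw [hh]
    exact hfix (cutoff_eq_zero_of_infDist_le (by rw [Metric.infDist_zero_of_mem hx]; exact hδ.le)) k
  · rintro _ ⟨y, hy, rfl⟩
    rw [Metric.mem_thickening_iff_infDist_lt ⟨p, hp⟩, hh]
    exact hk y hy
end

section
/- Let n ≥ 1 and let a be a countable closed subset of ℝⁿ. Then there is a countable closed set a' ⊆ ℝⁿ with a ⊆ a' such that for every countable closed set b ⊆ ℝⁿ and every ε > 0 there is a self-homeomorphism h of ℝⁿ with h x = x for all x ∈ a' and h '' b ⊆ {x : dist(x, a') < ε}. -/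
theorem exists_orderIso_eq_of_le {p c c' q : ℝ} (hpc : p < c) (hcc : c ≤ c') (hcq : c' < q) :
    ∃ e : ℝ ≃o ℝ, (∀ x ≤ p, e x = x) ∧ (∀ x, q ≤ x → e x = x) ∧ e c = c' := by
  set s := (c' - p) / (c - p) with hs
  set r := (q - c') / (q - c) with hr
  have hs1 : 1 ≤ s := by rw [hs, one_le_div (by linarith)]; linarith
  have hr0 : 0 < r := div_pos (by linarith) (by linarith)
  have hr1 : r ≤ 1 := by rw [hr, div_le_one (by linarith)]; linarith
  have hsc : s * (c - p) = c' - p := div_mul_cancel₀ _ (by linarith)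
  have hrc : r * (q - c) = q - c' := div_mul_cancel₀ _ (by linarith)
  let f : ℝ → ℝ := fun x => max x (min (p + s * (x - p)) (q + r * (x - q)))
  have hf : StrictMono f := by
    intro x y hxy
    exact max_lt_max hxy (min_lt_min (by nlinarith) (by nlinarith))
  have hfp : ∀ x ≤ p, f x = x := fun x hx =>
    max_eq_left ((min_le_left _ _).trans (by nlinarith))
  have hfq : ∀ x, q ≤ x → f x = x := fun x hx =>
    max_eq_left ((min_le_right _ _).trans (by nlinarith))
  have hfc : Continuous f := by fun_prop
  have hsurj : Function.Surjective f := by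
    intro y
    obtain ⟨x, -, hx⟩ := intermediate_value_Icc (a := min p y) (b := max q y)
      (le_trans (min_le_right _ _) (le_max_right _ _)) hfc.continuousOn
      (by rw [hfp _ (min_le_left _ _), hfq _ (le_max_left _ _)]
          exact ⟨min_le_right _ _, le_max_right _ _⟩)
    exact ⟨x, hx⟩
  refine ⟨StrictMono.orderIsoOfSurjective f hf hsurj, hfp, hfq, ?_⟩
  change max c (min (p + s * (c - p)) (q + r * (c - q))) = c'
  rw [show p + s * (c - p) = c' by linarith, show q + r * (c - q) = c' by linarith, min_self,
    max_eq_right hcc]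

theorem exists_orderIso_eq {p c c' q : ℝ} (hpc : p < c) (hcq : c < q) (hpc' : p < c')
    (hcq' : c' < q) :
    ∃ e : ℝ ≃o ℝ, (∀ x ≤ p, e x = x) ∧ (∀ x, q ≤ x → e x = x) ∧ e c = c' := by
  rcases le_total c c' with h | h
  · exact exists_orderIso_eq_of_le hpc h hcq'
  · obtain ⟨e, h1, h2, h3⟩ := exists_orderIso_eq_of_le hpc' h hcq
    exact ⟨e.symm, fun x hx => by rw [OrderIso.symm_apply_eq, h1 x hx],
      fun x hx => by rw [OrderIso.symm_apply_eq, h2 x hx], by rw [← h3, e.symm_apply_apply]⟩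

theorem exists_orderIso_eq₂ {p c d c' d' q : ℝ} (hpc : p < c) (hcd : c < d) (hdq : d < q)
    (hpc' : p < c') (hcd' : c' < d') (hdq' : d' < q) :
    ∃ e : ℝ ≃o ℝ, e p = p ∧ e q = q ∧ e c = c' ∧ e d = d' := by
  obtain ⟨e₁, h1, h2, h3⟩ := exists_orderIso_eq hpc (hcd.trans hdq) hpc' (hcd'.trans hdq')
  obtain ⟨e₂, k1, k2, k3⟩ := exists_orderIso_eq (p := c') (c := e₁ d) (c' := d') (q := q)
    (by rw [← h3]; exact e₁.strictMono hcd)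
    (by conv_rhs => rw [← h2 q le_rfl]
        exact e₁.strictMono hdq) hcd' hdq'
  refine ⟨e₁.trans e₂, ?_, ?_, ?_, ?_⟩
  · simp [h1 p le_rfl, k1 p hpc'.le]
  · simp [h2 q le_rfl, k2 q le_rfl]
  · simp [h3, k1 c' le_rfl]
  · simp [k3]

/-- Order automorphisms chosen separately on the complementary intervals of a closed set
glue to an order automorphism fixing the closed set. -/
theorem exists_orderIso_glue_gaps {A : Set ℝ} (hA : IsClosed A) (hlo : ∀ x, ∃ y ∈ A, y ≤ x)
    (hhi : ∀ x, ∃ y ∈ A, x ≤ y) (P : ℝ → ℝ → Prop)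
    (H : ∀ p ∈ A, ∀ q ∈ A, p < q → (∀ x ∈ Set.Ioo p q, x ∉ A) →
      ∃ e : ℝ ≃o ℝ, e p = p ∧ e q = q ∧ ∀ x ∈ Set.Ioo p q, P x (e x)) :
    ∃ g : ℝ ≃o ℝ, (∀ x ∈ A, g x = x) ∧ ∀ x ∉ A, P x (g x) := by
  classical
  have gap : ∀ x ∉ A, ∃ p ∈ A, ∃ q ∈ A, x ∈ Set.Ioo p q ∧ ∀ y ∈ Set.Ioo p q, y ∉ A := by
    intro x hx
    have hne1 : (A ∩ Set.Iic x).Nonempty := by obtain ⟨y, hy, hyx⟩ := hlo x; exact ⟨y, hy, hyx⟩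
    have hne2 : (A ∩ Set.Ici x).Nonempty := by obtain ⟨y, hy, hyx⟩ := hhi x; exact ⟨y, hy, hyx⟩
    have hb1 : BddAbove (A ∩ Set.Iic x) := ⟨x, fun y hy => hy.2⟩
    have hb2 : BddBelow (A ∩ Set.Ici x) := ⟨x, fun y hy => hy.2⟩
    have h1 := (hA.inter isClosed_Iic).csSup_mem hne1 hb1
    have h2 := (hA.inter isClosed_Ici).csInf_mem hne2 hb2
    refine ⟨_, h1.1, _, h2.1, ⟨lt_of_le_of_ne h1.2 fun h => hx (h ▸ h1.1),
      lt_of_le_of_ne h2.2 fun h => hx (h ▸ h2.1)⟩, fun y hy hyA => ?_⟩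
    rcases le_total y x with h | h
    · exact absurd (le_csSup hb1 ⟨hyA, h⟩) (not_le.2 hy.1)
    · exact absurd (csInf_le hb2 ⟨hyA, h⟩) (not_le.2 hy.2)
  have H' : ∀ p q, ∃ e : ℝ ≃o ℝ, p ∈ A → q ∈ A → p < q → (∀ x ∈ Set.Ioo p q, x ∉ A) →
      e p = p ∧ e q = q ∧ ∀ x ∈ Set.Ioo p q, P x (e x) := by
    intro p q
    by_cases h : p ∈ A ∧ q ∈ A ∧ p < q ∧ (∀ x ∈ Set.Ioo p q, x ∉ A)
    · obtain ⟨e, he⟩ := H p h.1 q h.2.1 h.2.2.1 h.2.2.2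
      exact ⟨e, fun _ _ _ _ => he⟩
    · exact ⟨OrderIso.refl ℝ, fun h1 h2 h3 h4 => absurd ⟨h1, h2, h3, h4⟩ h⟩
  choose ψ hψ using H'
  choose! p hpA q hqA hx hgap using gap
  let f : ℝ → ℝ := fun x => if x ∈ A then x else ψ (p x) (q x) x
  have fA : ∀ x ∈ A, f x = x := fun x hx => if_pos hx
  have key : ∀ s ∈ A, ∀ r ∈ A, ∀ y ∈ Set.Ioo s r, (∀ y ∈ Set.Ioo s r, y ∉ A) →
      f y = ψ s r y := by
    intro s hs r hr y hy hg
    have hyA := hg y hy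
    have e1 : p y = s := by
      apply le_antisymm
      · by_contra! h
        exact hg _ ⟨h, (hx y hyA).1.trans hy.2⟩ (hpA y hyA)
      · by_contra! h
        exact hgap y hyA s ⟨h, hy.1.trans (hx y hyA).2⟩ hs
    have e2 : q y = r := by
      apply le_antisymm
      · by_contra! h
        exact hgap y hyA r ⟨(hx y hyA).1.trans hy.2, h⟩ hr
      · by_contra! h
        exact hg _ ⟨hy.1.trans (hx y hyA).2, h⟩ (hqA y hyA)
    simp only [f, if_neg hyA, e1, e2]
  have spec : ∀ x ∉ A, f x = ψ (p x) (q x) x ∧ ψ (p x) (q x) (p x) = p x ∧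
      ψ (p x) (q x) (q x) = q x ∧ P x (f x) ∧ f x ∈ Set.Ioo (p x) (q x) := by
    intro x hxA
    have h0 := hx x hxA
    obtain ⟨h1, h2, h3⟩ := hψ (p x) (q x) (hpA x hxA) (hqA x hxA) (h0.1.trans h0.2) (hgap x hxA)
    have h4 : f x = ψ (p x) (q x) x := if_neg hxA
    refine ⟨h4, h1, h2, h4 ▸ h3 x h0, ?_, ?_⟩
    · rw [h4]; conv_lhs => rw [← h1]
      exact (ψ _ _).strictMono h0.1
    · rw [h4]; conv_rhs => rw [← h2]
      exact (ψ _ _).strictMono h0.2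
  have mono_le : ∀ x, ∀ r ∈ A, x < r → f x < r := by
    intro x r hr hxr
    by_cases hxA : x ∈ A
    · rwa [fA x hxA]
    · refine (spec x hxA).2.2.2.2.2.trans_le ?_
      by_contra! h
      exact hgap x hxA r ⟨(hx x hxA).1.trans hxr, h⟩ hr
  have mono_ge : ∀ x, ∀ r ∈ A, r < x → r < f x := by
    intro x r hr hxr
    by_cases hxA : x ∈ A
    · rwa [fA x hxA]
    · refine lt_of_le_of_lt ?_ (spec x hxA).2.2.2.2.1
      by_contra! h
      exact hgap x hxA r ⟨h, hxr.trans (hx x hxA).2⟩ hr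
  have hf : StrictMono f := by
    intro x y hxy
    by_cases hxA : x ∈ A
    · rw [fA x hxA]; exact mono_ge y x hxA hxy
    by_cases h : y < q x
    · rw [(spec x hxA).1, key (p x) (hpA x hxA) (q x) (hqA x hxA) y
        ⟨(hx x hxA).1.trans hxy, h⟩ (hgap x hxA)]
      exact (ψ _ _).strictMono hxy
    · rcases (not_lt.1 h).eq_or_lt with h | h
      · rw [← h, fA _ (hqA x hxA)]; exact (spec x hxA).2.2.2.2.2
      · exact (spec x hxA).2.2.2.2.2.trans (mono_ge y _ (hqA x hxA) h)
  have hsurj : Function.Surjective f := by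
    intro y
    by_cases hy : y ∈ A
    · exact ⟨y, fA y hy⟩
    · obtain ⟨-, h1, h2, -⟩ := spec y hy
      refine ⟨(ψ (p y) (q y)).symm y, ?_⟩
      rw [key (p y) (hpA y hy) (q y) (hqA y hy) _ ⟨?_, ?_⟩ (hgap y hy), OrderIso.apply_symm_apply]
      · rw [OrderIso.lt_symm_apply, h1]; exact (hx y hy).1
      · rw [OrderIso.symm_apply_lt, h2]; exact (hx y hy).2
  exact ⟨StrictMono.orderIsoOfSurjective f hf hsurj, fA, fun x hx => (spec x hx).2.2.2.1⟩

/-- Inside an open interval, a compact countable set can be pushed into any uniform neighbourhood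
of a compact set, rel that set; the cut-off function `τ` records that the support is compact. -/
theorem exists_orderIso_push {u v ε : ℝ} (hε : 0 < ε) {A B : Set ℝ} (hA : IsCompact A)
    (hAne : A.Nonempty) (hB : IsCompact B) (hBc : B.Countable) (hAu : A ⊆ Set.Ioo u v)
    (hBu : B ⊆ Set.Ioo u v) :
    ∃ (g : ℝ ≃o ℝ) (τ : ℝ → ℝ), Continuous τ ∧ (∀ x, τ x ∈ Set.Icc (0 : ℝ) 1) ∧
      (∀ x ∉ Set.Ioo u v, g x = x ∧ τ x = 0) ∧ (∀ x ∈ A, g x = x) ∧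
      ∀ x ∈ B, g x ∈ Metric.thickening ε A ∧ τ x = 1 ∧ τ (g x) = 1 := by
  have hAB := hA.union hB
  have hABne : (A ∪ B).Nonempty := hAne.inl
  have hABu : A ∪ B ⊆ Set.Ioo u v := Set.union_subset hAu hBu
  obtain ⟨k', hk', hk'le⟩ := hAB.exists_isLeast hABne
  obtain ⟨l', hl', hl'le⟩ := hAB.exists_isGreatest hABne
  obtain ⟨k, huk, hkk⟩ := exists_between (hABu hk').1
  obtain ⟨l, hll, hlv⟩ := exists_between (hABu hl').2
  have hkl : k' ≤ l' := hk'le hl'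
  have hin : ∀ x ∈ A ∪ B, k' ≤ x ∧ x ≤ l' := fun x hx => ⟨hk'le hx, hl'le hx⟩
  obtain ⟨g, hg1, hg2⟩ := exists_orderIso_glue_gaps (A := A ∪ Set.Iic k ∪ Set.Ici l)
    ((hA.isClosed.union isClosed_Iic).union isClosed_Ici)
    (fun x => ⟨min x k, Or.inl (Or.inr (Set.mem_Iic.2 (min_le_right _ _))), min_le_left _ _⟩)
    (fun x => ⟨max x l, Or.inr (Set.mem_Ici.2 (le_max_right _ _)), le_max_left _ _⟩)
    (fun x y => x ∈ B → y ∈ Metric.thickening ε A) (by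
      intro p hp q hq hpq hgap
      have hkp : k ≤ p := by
        by_contra! h
        obtain ⟨x, hx1, hx2⟩ := exists_between (lt_min h hpq)
        exact hgap x ⟨hx1, hx2.trans_le (min_le_right _ _)⟩
          (Or.inl (Or.inr (hx2.le.trans (min_le_left _ _))))
      have hql : q ≤ l := by
        by_contra! h
        obtain ⟨x, hx1, hx2⟩ := exists_between (max_lt h hpq)
        exact hgap x ⟨(le_max_right _ _).trans_lt hx1, hx2⟩
          (Or.inr ((le_max_left _ _).trans hx1.le))
      have hpA : p ∉ A → p = k := by
        rintro h
        rcases hp with (hp | hp) | hp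
        · exact absurd hp h
        · exact le_antisymm hp hkp
        · exact absurd (hpq.trans_le hql) (not_lt.2 hp)
      have hqA : q ∉ A → q = l := by
        rintro h
        rcases hq with (hq | hq) | hq
        · exact absurd hq h
        · exact absurd (hkp.trans_lt hpq) (not_lt.2 hq)
        · exact le_antisymm hql hq
      have free : ∀ s r : ℝ, s < r → ∃ m ∈ Set.Ioo s r, m ∉ B := by
        intro s r hsr
        by_contra! h
        exact (Cardinal.Real.Ioo_countable_iff.not.2 (not_le.2 hsr)) (hBc.mono h)
      obtain ⟨m, hm, hmB, hmp, hmq⟩ : ∃ m ∈ Set.Ioo p q, m ∉ B ∧ (p ∉ A → m < k') ∧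
          (q ∉ A → l' < m) := by
        by_cases h1 : p ∈ A
        · by_cases h2 : q ∈ A
          · obtain ⟨m, hm, hmB⟩ := free p q hpq
            exact ⟨m, hm, hmB, fun h => absurd h1 h, fun h => absurd h2 h⟩
          · obtain ⟨m, hm, hmB⟩ := free (max p l') q (max_lt hpq (hqA h2 ▸ hll))
            exact ⟨m, ⟨(le_max_left _ _).trans_lt hm.1, hm.2⟩, hmB, fun h => absurd h1 h,
              fun _ => (le_max_right _ _).trans_lt hm.1⟩
        · have h2 : q ∈ A := by
            by_contra h2
            obtain ⟨x, hx⟩ := hAne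
            have := hin x (Or.inl hx)
            exact hgap x ⟨by rw [hpA h1]; linarith, by rw [hqA h2]; linarith⟩
              (Or.inl (Or.inl hx))
          obtain ⟨m, hm, hmB⟩ := free p (min q k') (lt_min hpq (hpA h1 ▸ hkk))
          exact ⟨m, ⟨hm.1, hm.2.trans_le (min_le_left _ _)⟩, hmB,
            fun _ => hm.2.trans_le (min_le_right _ _), fun h => absurd h2 h⟩
      obtain ⟨c, d, hcm, hcd⟩ : ∃ c d, m ∈ Set.Ioo c d ∧ Set.Ioo c d ⊆ Bᶜ ∩ Set.Ioo p q :=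
        mem_nhds_iff_exists_Ioo_subset.1
          (Filter.inter_mem (hB.isClosed.isOpen_compl.mem_nhds hmB) (Ioo_mem_nhds hm.1 hm.2))
      obtain ⟨c₁, hc₁, hc₁m⟩ := exists_between hcm.1
      obtain ⟨d₁, hmd₁, hd₁⟩ := exists_between hcm.2
      have hc₁pq := (hcd ⟨hc₁, by linarith [hcm.2]⟩).2
      have hd₁pq := (hcd ⟨by linarith [hcm.1], hd₁⟩).2
      obtain ⟨η, hη, hηlt⟩ := exists_between (lt_min hε (half_pos (sub_pos.2 hpq)))
      have hηε := hηlt.trans_le (min_le_left _ _)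
      have hηpq := hηlt.trans_le (min_le_right _ _)
      obtain ⟨e, e1, e2, e3, e4⟩ := exists_orderIso_eq₂ (p := p) (c := c₁) (d := d₁)
        (c' := p + η) (d' := q - η) (q := q) hc₁pq.1 (by linarith) hd₁pq.2 (by linarith)
        (by linarith) (by linarith)
      refine ⟨e, e1, e2, fun x hx hxB => ?_⟩
      have hep : p < e x := by
        conv_lhs => rw [← e1]
        exact e.strictMono hx.1
      have heq : e x < q := by
        conv_rhs => rw [← e2]
        exact e.strictMono hx.2
      have hxm := hin x (Or.inr hxB)
      rw [Metric.mem_thickening_iff]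
      by_cases hxc : x < c₁
      · refine ⟨p, by_contra fun h => ?_, ?_⟩
        · linarith [hmp h]
        · have := e.strictMono hxc
          rw [Real.dist_eq, abs_lt]; constructor <;> linarith
      · have hdx : d₁ < x := by
          by_contra! h
          exact (hcd ⟨by linarith, by linarith⟩).1 hxB
        refine ⟨q, by_contra fun h => ?_, ?_⟩
        · linarith [hmq h]
        · have := e.strictMono hdx
          rw [Real.dist_eq, abs_lt]; constructor <;> linarith)
  have hgk : g k = k := hg1 k (Or.inl (Or.inr Set.self_mem_Iic))
  have hgl : g l = l := hg1 l (Or.inr Set.self_mem_Ici)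
  obtain ⟨τ, hτ0, hτ1, hτ⟩ := exists_continuous_zero_one_of_isClosed
    (isOpen_Ioo (a := u) (b := v)).isClosed_compl (isClosed_Icc (a := k) (b := l))
    (Set.disjoint_left.2 fun x hx hx' => hx ⟨by linarith [hx'.1], by linarith [hx'.2]⟩)
  refine ⟨g, τ, τ.continuous, hτ, fun x hx => ⟨hg1 x ?_, hτ0 hx⟩,
    fun x hx => hg1 x (Or.inl (Or.inl hx)), fun x hx => ?_⟩
  · by_contra h
    simp only [Set.mem_union, Set.mem_Iic, Set.mem_Ici, not_or, not_le] at h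
    exact hx ⟨by linarith, by linarith⟩
  · have hxm := hin x (Or.inr hx)
    refine ⟨?_, hτ1 ⟨by linarith, by linarith⟩, hτ1 ⟨?_, ?_⟩⟩
    · by_cases hxA : x ∈ A ∪ Set.Iic k ∪ Set.Ici l
      · rw [hg1 x hxA]
        rcases hxA with (h | h) | h
        · exact Metric.self_subset_thickening hε _ h
        · exact absurd h (by simp; linarith)
        · exact absurd h (by simp; linarith)
      · exact hg2 x hxA hx
    · rw [← hgk]; exact g.monotone (by linarith)
    · rw [← hgl]; exact g.monotone (by linarith)

theorem exists_homeomorph_of_eqOn_compl_compact {X : Type*} [TopologicalSpace X] [T2Space X]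
    [CompactlyCoherentSpace X] {f : X → X} (hf : Continuous f) (hbij : f.Bijective) {K : Set X}
    (hK : IsCompact K) (hfK : ∀ x ∉ K, f x = x) : ∃ h : X ≃ₜ X, ⇑h = f := by
  have htend : Filter.Tendsto f (Filter.cocompact X) (Filter.cocompact X) := by
    refine Filter.tendsto_id.congr' ?_
    filter_upwards [hK.compl_mem_cocompact] with x hx using (hfK x hx).symm
  exact ⟨(Equiv.ofBijective f hbij).toHomeomorphOfContinuousClosed hf
    (isProperMap_iff_tendsto_cocompact.2 ⟨hf, htend⟩).isClosedMap, rfl⟩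

/-- The shear applying `g` to the `i`-th coordinate, interpolated to the identity by cut-offs in the
other coordinates. -/
theorem exists_shear {ι : Type*} [Fintype ι] [DecidableEq ι] (u v : ι → ℝ)
    (i : ι) (g : ℝ ≃o ℝ) (hg : ∀ x ∉ Set.Ioo (u i) (v i), g x = x) (τ : ι → ℝ → ℝ)
    (hτc : ∀ j, Continuous (τ j)) (hτ : ∀ j x, τ j x ∈ Set.Icc (0 : ℝ) 1)
    (hτ0 : ∀ j, ∀ x ∉ Set.Ioo (u j) (v j), τ j x = 0) :
    ∃ S : (ι → ℝ) ≃ₜ (ι → ℝ), (∀ x, (∃ j, x j ∉ Set.Ioo (u j) (v j)) → S x = x) ∧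
      (∀ x, g (x i) = x i → S x = x) ∧
      ∀ x, (∀ j, τ j (x j) = 1) → S x = Function.update x i (g (x i)) := by
  let t : (ι → ℝ) → ℝ := fun x => ∏ j ∈ Finset.univ.erase i, τ j (x j)
  have ht : ∀ x, t x ∈ Set.Icc (0 : ℝ) 1 := fun x =>
    ⟨Finset.prod_nonneg fun j _ => (hτ j _).1,
      Finset.prod_le_one (fun j _ => (hτ j _).1) fun j _ => (hτ j _).2⟩
  have htu : ∀ x y : ι → ℝ, (∀ j ≠ i, x j = y j) → t x = t y := fun x y hxy =>
    Finset.prod_congr rfl fun j hj => by rw [hxy j (Finset.ne_of_mem_erase hj)]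
  let φ : ℝ → ℝ → ℝ := fun r s => (1 - r) * s + r * g s
  have hφ : ∀ r ∈ Set.Icc (0 : ℝ) 1, StrictMono (φ r) := by
    intro r hr x y hxy
    have h2 := g.strictMono hxy
    rcases hr.1.eq_or_lt with h | h
    · simpa [φ, ← h] using hxy
    · have := mul_lt_mul_of_pos_left h2 h
      have := mul_le_mul_of_nonneg_left hxy.le (sub_nonneg.2 hr.2)
      simp only [φ]; linarith
  have hφfix : ∀ r s, g s = s → φ r s = s := fun r s h => by simp only [φ, h]; ring
  have hφs : ∀ r, Function.Surjective (φ r) := by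
    intro r y
    have h1 := hφfix r (min (u i) y) (hg _ fun h => absurd h.1 (not_lt.2 (min_le_left _ _)))
    have h2 := hφfix r (max (v i) y) (hg _ fun h => absurd h.2 (not_lt.2 (le_max_left _ _)))
    have hc : Continuous (φ r) := by
      have := g.continuous
      simp only [φ]; fun_prop
    obtain ⟨x, -, hx⟩ := intermediate_value_Icc (a := min (u i) y) (b := max (v i) y)
      (le_trans (min_le_right _ _) (le_max_right _ _)) hc.continuousOn
      (by rw [h1, h2]; exact ⟨min_le_right _ _, le_max_right _ _⟩)
    exact ⟨x, hx⟩
  let f : (ι → ℝ) → ι → ℝ := fun x => Function.update x i (φ (t x) (x i))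
  have hfi : ∀ x, f x i = φ (t x) (x i) := fun x => Function.update_self ..
  have hfj : ∀ x, ∀ j ≠ i, f x j = x j := fun x j hj => Function.update_of_ne hj ..
  have hffix : ∀ x, φ (t x) (x i) = x i → f x = x := fun x hx => by
    simp only [f, hx, Function.update_eq_self]
  have hf1 : ∀ x, g (x i) = x i → f x = x := fun x hx => hffix x (hφfix _ _ hx)
  have hf2 : ∀ x, (∃ j, x j ∉ Set.Ioo (u j) (v j)) → f x = x := by
    rintro x ⟨j, hj⟩
    by_cases hji : j = i
    · subst hji; exact hf1 x (hg _ hj)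
    · have : t x = 0 :=
        Finset.prod_eq_zero (Finset.mem_erase.2 ⟨hji, Finset.mem_univ j⟩) (hτ0 j _ hj)
      exact hffix x (by simp [φ, this])
  have hc : Continuous f := by
    have := g.continuous
    have : Continuous t := continuous_finsetProd _ fun j _ => (hτc j).comp (continuous_apply j)
    exact continuous_id.update i (by simp only [φ]; fun_prop)
  have hinj : f.Injective := by
    intro x y hxy
    have h1 : ∀ j ≠ i, x j = y j := fun j hj => by rw [← hfj x j hj, hxy, hfj y j hj]
    ext j
    by_cases hj : j = i
    · subst hj
      have := congrFun hxy j
      rw [hfi, hfi, htu x y h1] at this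
      exact (hφ _ (ht y)).injective this
    · exact h1 j hj
  have hsurj : f.Surjective := by
    intro y
    obtain ⟨s, hs⟩ := hφs (t y) (y i)
    refine ⟨Function.update y i s, ?_⟩
    have : t (Function.update y i s) = t y := htu _ _ fun j hj => Function.update_of_ne hj ..
    simp only [f, this, Function.update_self, hs, Function.update_idem, Function.update_eq_self]
  obtain ⟨S, hS⟩ := exists_homeomorph_of_eqOn_compl_compact hc ⟨hinj, hsurj⟩
    (isCompact_univ_pi fun j => isCompact_Icc (a := u j) (b := v j)) (fun x hx => hf2 x (by
      by_contra! h
      exact hx fun j _ => Set.Ioo_subset_Icc_self (h j)))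
  refine ⟨S, by rwa [hS], by rwa [hS], fun x hx => ?_⟩
  have : t x = 1 := Finset.prod_eq_one fun j _ => hx j
  rw [hS]
  simp [f, φ, this]

/-- Inside an open box, a compact countable set can be pushed into any neighbourhood of a
product of compact sets, rel that product and the complement of the box. -/
theorem exists_homeomorph_box {ι : Type*} [Fintype ι] (u v : ι → ℝ) (A : ι → Set ℝ)
    (hA : ∀ i, IsCompact (A i)) (hAne : ∀ i, (A i).Nonempty) (hAu : ∀ i, A i ⊆ Set.Ioo (u i) (v i))
    {b : Set (ι → ℝ)} (hb : IsCompact b) (hbc : b.Countable)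
    (hbu : ∀ x ∈ b, ∀ i, x i ∈ Set.Ioo (u i) (v i)) {V : Set (ι → ℝ)} (hV : IsOpen V)
    (hAV : Set.univ.pi A ⊆ V) :
    ∃ h : (ι → ℝ) ≃ₜ (ι → ℝ), (∀ x, (∃ j, x j ∉ Set.Ioo (u j) (v j)) → h x = x) ∧
      (∀ x ∈ Set.univ.pi A, h x = x) ∧ ∀ x ∈ b, h x ∈ V := by
  classical
  obtain ⟨ε, hε, hεV⟩ := (isCompact_univ_pi hA).exists_thickening_subset_open hV hAV
  have hB : ∀ i, IsCompact ((fun x : ι → ℝ => x i) '' b) := fun i =>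
    hb.image (continuous_apply i)
  choose g τ hτc hτ hout hfix hpush using fun i => exists_orderIso_push hε (hA i) (hAne i) (hB i)
    (hbc.image _) (hAu i) (by rintro _ ⟨x, hx, rfl⟩; exact hbu x hx i)
  have key : ∀ s : Finset ι, ∃ h : (ι → ℝ) ≃ₜ (ι → ℝ),
      (∀ x, (∃ j, x j ∉ Set.Ioo (u j) (v j)) → h x = x) ∧ (∀ x ∈ Set.univ.pi A, h x = x) ∧
      ∀ x ∈ b, ∀ i, h x i = if i ∈ s then g i (x i) else x i := by
    intro s
    induction s using Finset.induction_on with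
    | empty => exact ⟨Homeomorph.refl _, by simp⟩
    | insert i s his ih =>
      obtain ⟨h, h1, h2, h3⟩ := ih
      obtain ⟨S, S1, S2, S3⟩ := exists_shear u v i (g i) (fun x hx => (hout i x hx).1) τ hτc hτ
        (fun j x hx => (hout j x hx).2)
      refine ⟨h.trans S, fun x hx => ?_, fun x hx => ?_, fun x hx j => ?_⟩
      · rw [Homeomorph.trans_apply, h1 x hx, S1 x hx]
      · rw [Homeomorph.trans_apply, h2 x hx, S2 x (hfix i _ (hx i trivial))]
      · have hxj : ∀ j, τ j (h x j) = 1 := fun j => by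
          have := hpush j (x j) ⟨x, hx, rfl⟩
          rw [h3 x hx]
          split_ifs
          exacts [this.2.2, this.2.1]
        rw [Homeomorph.trans_apply, S3 _ hxj]
        by_cases hj : j = i
        · subst hj
          simp [h3 x hx, his]
        · simp [h3 x hx, hj]
  obtain ⟨h, h1, h2, h3⟩ := key Finset.univ
  refine ⟨h, h1, h2, fun x hx => hεV ?_⟩
  choose y hy hxy using fun i => Metric.mem_thickening_iff.1 (hpush i (x i) ⟨x, hx, rfl⟩).1
  refine Metric.mem_thickening_iff.2 ⟨y, fun i _ => hy i, (dist_pi_lt_iff hε).2 fun i => ?_⟩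
  rw [h3 x hx, if_pos (Finset.mem_univ i)]
  exact hxy i

/-- The closed unit cube with integer corner `z`. -/
def latticeCube {ι : Type*} (z : ι → ℤ) : Set (ι → ℝ) :=
  Set.univ.pi fun i => Set.Icc (z i : ℝ) (z i + 1)

theorem mem_latticeCube_floor {ι : Type*} (x : ι → ℝ) : x ∈ latticeCube fun i => ⌊x i⌋ :=
  fun _ _ => ⟨Int.floor_le _, (Int.lt_floor_add_one _).le⟩

theorem isCompact_latticeCube {ι : Type*} (z : ι → ℤ) : IsCompact (latticeCube z) :=
  isCompact_univ_pi fun _ => isCompact_Icc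

theorem locallyFinite_latticeCube {ι : Type*} [Fintype ι] :
    LocallyFinite (latticeCube : (ι → ℤ) → Set (ι → ℝ)) := by
  classical
  intro x
  refine ⟨Metric.ball x 1, Metric.ball_mem_nhds x one_pos,
    (Set.finite_Icc (fun i => ⌊x i⌋ - 2) (fun i => ⌊x i⌋ + 2)).subset ?_⟩
  rintro z ⟨y, hy, hyx⟩
  have h : ∀ i, ⌊x i⌋ - 2 ≤ z i ∧ z i ≤ ⌊x i⌋ + 2 := by
    intro i
    have h1 := (dist_le_pi_dist y x i).trans_lt (Metric.mem_ball.1 hyx)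
    rw [Real.dist_eq, abs_lt] at h1
    obtain ⟨h2, h3⟩ := hy i trivial
    have h4 := Int.floor_le (x i)
    have h5 := Int.lt_floor_add_one (x i)
    constructor
    · have : ((⌊x i⌋ - 2 : ℤ) : ℝ) < z i + 1 := by push_cast; linarith
      exact_mod_cast Int.lt_add_one_iff.1 (by exact_mod_cast this)
    · have : (z i : ℝ) < ((⌊x i⌋ + 2 : ℤ) : ℝ) + 1 := by push_cast; linarith
      exact_mod_cast Int.lt_add_one_iff.1 (by exact_mod_cast this)
  exact ⟨fun i => (h i).1, fun i => (h i).2⟩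

theorem floor_eq_of_mem_Ioo {z : ℤ} {x : ℝ} (hx : x ∈ Set.Ioo (z : ℝ) (z + 1)) : ⌊x⌋ = z :=
  Int.floor_eq_iff.2 ⟨hx.1.le, hx.2⟩

theorem floor_glue_eq {ι : Type*} {h : (ι → ℤ) → (ι → ℝ) → ι → ℝ}
    (hh : ∀ z x, (∃ j, x j ∉ Set.Ioo (z j : ℝ) (z j + 1)) → h z x = x) (z : ι → ℤ)
    {x : ι → ℝ} (hx : x ∈ latticeCube z) : h (fun i => ⌊x i⌋) x = h z x := by
  by_cases hz : ∃ j, x j ∉ Set.Ioo (z j : ℝ) (z j + 1)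
  · rw [hh z x hz]
    refine hh _ x ?_
    obtain ⟨j, hj⟩ := hz
    refine ⟨j, fun hj' => ?_⟩
    obtain ⟨h1, h2⟩ := hx j trivial
    rcases h1.eq_or_lt with h1 | h1
    · rw [← h1, Int.floor_intCast] at hj'
      exact lt_irrefl _ hj'.1
    · rcases h2.eq_or_lt with h2 | h2
      · have h3 : x j = ((z j + 1 : ℤ) : ℝ) := by push_cast; exact h2
        rw [h3, Int.floor_intCast] at hj'
        exact lt_irrefl _ hj'.1
      · exact hj ⟨h1, h2⟩
  · push Not at hz
    congr 1
    ext i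
    exact floor_eq_of_mem_Ioo (hz i)

theorem continuous_floor_glue {ι : Type*} [Fintype ι] {h : (ι → ℤ) → (ι → ℝ) → ι → ℝ}
    (hc : ∀ z, Continuous (h z))
    (hh : ∀ z x, (∃ j, x j ∉ Set.Ioo (z j : ℝ) (z j + 1)) → h z x = x) :
    Continuous fun x => h (fun i => ⌊x i⌋) x :=
  locallyFinite_latticeCube.continuous
    (Set.eq_univ_of_forall fun x => Set.mem_iUnion.2 ⟨_, mem_latticeCube_floor x⟩)
    (fun z => (isCompact_latticeCube z).isClosed)
    (fun z => (hc z).continuousOn.congr fun _ hx => floor_glue_eq hh z hx)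

theorem exists_homeomorph_floor_glue {ι : Type*} [Fintype ι]
    (h : (ι → ℤ) → (ι → ℝ) ≃ₜ (ι → ℝ))
    (hh : ∀ z x, (∃ j, x j ∉ Set.Ioo (z j : ℝ) (z j + 1)) → h z x = x) :
    ∃ F : (ι → ℝ) ≃ₜ (ι → ℝ), ∀ x, F x = h (fun i => ⌊x i⌋) x := by
  have hh' : ∀ z x, (∃ j, x j ∉ Set.Ioo (z j : ℝ) (z j + 1)) → (h z).symm x = x := fun z x hx => by
    rw [Homeomorph.symm_apply_eq, hh z x hx]
  have aux : ∀ (k : (ι → ℤ) → (ι → ℝ) ≃ₜ (ι → ℝ)),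
      (∀ z x, (∃ j, x j ∉ Set.Ioo (z j : ℝ) (z j + 1)) → k z x = x) →
      (∀ z x, (∃ j, x j ∉ Set.Ioo (z j : ℝ) (z j + 1)) → (k z).symm x = x) →
      ∀ x, k (fun i => ⌊(k (fun i => ⌊x i⌋)).symm x i⌋) ((k (fun i => ⌊x i⌋)).symm x) = x := by
    intro k hk hk' x
    rw [floor_glue_eq (h := fun z => k z) hk (fun i => ⌊x i⌋), Homeomorph.apply_symm_apply]
    by_contra hx
    have hz : ∃ j, (k (fun i => ⌊x i⌋)).symm x j ∉ Set.Ioo (⌊x j⌋ : ℝ) (⌊x j⌋ + 1) := by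
      by_contra! hz
      exact hx fun i _ => Set.Ioo_subset_Icc_self (hz i)
    have := hk (fun i => ⌊x i⌋) _ hz
    rw [Homeomorph.apply_symm_apply] at this
    rw [← this] at hx
    exact hx (mem_latticeCube_floor x)
  exact ⟨{ toFun := fun x => h (fun i => ⌊x i⌋) x
           invFun := fun x => (h fun i => ⌊x i⌋).symm x
           left_inv := aux (fun z => (h z).symm) hh' hh
           right_inv := aux h hh hh'
           continuous_toFun := continuous_floor_glue (fun z => (h z).continuous) hh
           continuous_invFun := continuous_floor_glue (h := fun z => (h z).symm)
              (fun z => (h z).symm.continuous) hh' }, fun _ => rfl⟩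

/-- A countable set can be moved off the integer grid, rel a closed set missing the grid. -/
theorem exists_homeomorph_off_grid {ι : Type*} [Fintype ι] {a b : Set (ι → ℝ)} (ha : IsClosed a)
    (hane : a.Nonempty) (hag : ∀ x ∈ a, ∀ i, ∀ m : ℤ, x i ≠ m) (hb : b.Countable) :
    ∃ h : (ι → ℝ) ≃ₜ (ι → ℝ), (∀ x ∈ a, h x = x) ∧ ∀ x ∈ b, ∀ i, ∀ m : ℤ, h x i ≠ m := by
  have hbad : (⋃ x ∈ b, ⋃ (i : ι), ⋃ (m : ℤ), {((m : ℝ) - x i) / Metric.infDist x a}).Countable :=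
    hb.biUnion fun x _ => Set.countable_iUnion fun i => Set.countable_iUnion fun m =>
      Set.countable_singleton _
  obtain ⟨t, ht, htb⟩ : ∃ t ∈ Set.Ioo (0 : ℝ) 1,
      t ∉ ⋃ x ∈ b, ⋃ (i : ι), ⋃ (m : ℤ), {((m : ℝ) - x i) / Metric.infDist x a} := by
    by_contra! h
    exact absurd (Cardinal.Real.Ioo_countable_iff.1 (hbad.mono h)) (by norm_num)
  let f : (ι → ℝ) → ι → ℝ := fun x => x + fun _ => t * Metric.infDist x a
  have hf : ApproximatesLinearOn f
      ((ContinuousLinearEquiv.refl ℝ (ι → ℝ) : (ι → ℝ) ≃L[ℝ] (ι → ℝ)) : (ι → ℝ) →L[ℝ] (ι → ℝ))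
      Set.univ ⟨t, ht.1.le⟩ := by
    intro x _ y _
    have h1 : f x - f y - ((ContinuousLinearEquiv.refl ℝ (ι → ℝ) : (ι → ℝ) ≃L[ℝ] (ι → ℝ)) :
        (ι → ℝ) →L[ℝ] (ι → ℝ)) (x - y)
        = fun _ => t * (Metric.infDist x a - Metric.infDist y a) := by
      ext i
      simp [f]
      ring
    rw [h1, pi_norm_le_iff_of_nonneg (by have := ht.1; positivity)]
    intro i
    rw [norm_mul, Real.norm_of_nonneg ht.1.le, ← dist_eq_norm, ← dist_eq_norm]
    exact mul_le_mul_of_nonneg_left ((Metric.lipschitz_infDist_pt a).dist_le_mul x y |>.trans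
      (by simp)) ht.1.le
  have hc : Subsingleton (ι → ℝ) ∨ (⟨t, ht.1.le⟩ : NNReal) <
      ‖((ContinuousLinearEquiv.refl ℝ (ι → ℝ)).symm : (ι → ℝ) →L[ℝ] (ι → ℝ))‖₊⁻¹ := by
    rcases subsingleton_or_nontrivial (ι → ℝ) with h | h
    · exact Or.inl h
    · right
      have : ‖((ContinuousLinearEquiv.refl ℝ (ι → ℝ)).symm : (ι → ℝ) →L[ℝ] (ι → ℝ))‖₊ = 1 :=
        ContinuousLinearMap.nnnorm_id
      rw [this, inv_one]
      exact ht.2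
  have hfx : ∀ x ∈ a, f x = x := fun x hx => by
    ext i
    simp [f, Metric.infDist_zero_of_mem hx]
  refine ⟨hf.toHomeomorph f hc, hfx, fun x hx i m => ?_⟩
  change f x i ≠ m
  by_cases hxa : x ∈ a
  · rw [hfx x hxa]; exact hag x hxa i m
  · have hpos := (ha.notMem_iff_infDist_pos hane).1 hxa
    intro h
    apply htb
    simp only [Set.mem_iUnion, Set.mem_singleton_iff]
    refine ⟨x, hx, i, m, ?_⟩
    rw [eq_div_iff hpos.ne', ← h]
    simp [f]

/-- Every countable closed set can be moved into every neighbourhood of `a`, rel `a`. -/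
def AbsorbsCountableClosed {X : Type*} [TopologicalSpace X] (a : Set X) : Prop :=
  ∀ b : Set X, b.Countable → IsClosed b → ∀ V : Set X, IsOpen V → a ⊆ V →
    ∃ h : X ≃ₜ X, (∀ x ∈ a, h x = x) ∧ ∀ x ∈ b, h x ∈ V

theorem AbsorbsCountableClosed.preimage {X Y : Type*} [TopologicalSpace X] [TopologicalSpace Y]
    {a : Set Y} (ha : AbsorbsCountableClosed a) (e : X ≃ₜ Y) :
    AbsorbsCountableClosed (e ⁻¹' a) := by
  intro b hb hbC V hV haV
  obtain ⟨h, h1, h2⟩ := ha (e '' b) (hb.image e) (e.isClosedMap b hbC) (e '' V) (e.isOpenMap V hV)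
    (fun x hx => ⟨e.symm x, haV (by simpa using hx), by simp⟩)
  refine ⟨(e.trans h).trans e.symm, fun x hx => by simp [h1 (e x) hx], fun x hx => ?_⟩
  obtain ⟨y, hy, hyx⟩ := h2 (e x) ⟨x, hx, rfl⟩
  simpa [← hyx] using hy

theorem exists_absorbs_of_off_grid {ι : Type*} [Fintype ι] {a : Set (ι → ℝ)} (ha : a.Countable)
    (haC : IsClosed a) (hag : ∀ x ∈ a, ∀ i, ∀ m : ℤ, x i ≠ m) :
    ∃ a' : Set (ι → ℝ), a'.Countable ∧ IsClosed a' ∧ a ⊆ a' ∧ AbsorbsCountableClosed a' := by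
  have hIoo : ∀ {c : Set (ι → ℝ)}, (∀ x ∈ c, ∀ i, ∀ m : ℤ, x i ≠ m) → ∀ z, ∀ x ∈ c ∩ latticeCube z,
      ∀ i, x i ∈ Set.Ioo (z i : ℝ) (z i + 1) := by
    rintro c hc z x ⟨hx, hxz⟩ i
    obtain ⟨h1, h2⟩ := hxz i trivial
    exact ⟨lt_of_le_of_ne h1 (hc x hx i (z i)).symm,
      lt_of_le_of_ne h2 (by have := hc x hx i (z i + 1); push_cast at this; exact this)⟩
  let A : (ι → ℤ) → ι → Set ℝ := fun z i =>
    insert ((z i : ℝ) + 1 / 2) ((fun x : ι → ℝ => x i) '' (a ∩ latticeCube z))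
  have hAK : ∀ z i, IsCompact (A z i) := fun z i =>
    (((isCompact_latticeCube z).inter_left haC).image (continuous_apply i)).insert _
  have hAc : ∀ z i, (A z i).Countable := fun z i => ((ha.mono Set.inter_subset_left).image _).insert _
  have hAu : ∀ z i, A z i ⊆ Set.Ioo (z i : ℝ) (z i + 1) := by
    rintro z i _ (rfl | ⟨x, hx, rfl⟩)
    · constructor <;> linarith
    · exact hIoo hag z x hx i
  have hAcube : ∀ z, Set.univ.pi (A z) ⊆ latticeCube z := fun z x hx i hi =>
    Set.Ioo_subset_Icc_self (hAu z i (hx i hi))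
  have hC : IsClosed (⋃ z, Set.univ.pi (A z)) :=
    (locallyFinite_latticeCube.subset hAcube).isClosed_iUnion
      fun z => (isCompact_univ_pi (hAK z)).isClosed
  have hg : ∀ x ∈ ⋃ z, Set.univ.pi (A z), ∀ i, ∀ m : ℤ, x i ≠ m := by
    intro x hx i m hm
    obtain ⟨z, hz⟩ := Set.mem_iUnion.1 hx
    have h := hAu z i (hz i trivial)
    rw [hm] at h
    have h1 : z i < m := by exact_mod_cast h.1
    have h2 : m < z i + 1 := by exact_mod_cast h.2
    lia
  refine ⟨⋃ z, Set.univ.pi (A z), Set.countable_iUnion fun z => Set.countable_univ_pi (hAc z), hC,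
    fun x hx => Set.mem_iUnion.2 ⟨fun i => ⌊x i⌋, fun i _ =>
      Or.inr ⟨x, ⟨hx, mem_latticeCube_floor x⟩, rfl⟩⟩, ?_⟩
  intro b hb hbC V hV haV
  obtain ⟨h₀, h₀a, h₀b⟩ := exists_homeomorph_off_grid hC
    (Set.nonempty_iUnion.2 ⟨0, fun i => ((0 : ι → ℤ) i : ℝ) + 1 / 2, fun i _ => Or.inl rfl⟩) hg hb
  have hg₀ : ∀ x ∈ h₀ '' b, ∀ i, ∀ m : ℤ, x i ≠ m := by
    rintro _ ⟨x, hx, rfl⟩; exact h₀b x hx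
  choose h h1 h2 h3 using fun z => exists_homeomorph_box (fun i => (z i : ℝ)) (fun i => z i + 1)
    (A z) (hAK z) (fun i => Set.insert_nonempty _ _) (hAu z) (b := h₀ '' b ∩ latticeCube z)
    ((isCompact_latticeCube z).inter_left (h₀.isClosedMap b hbC))
    ((hb.image h₀).mono Set.inter_subset_left) (hIoo hg₀ z) hV
    ((Set.subset_iUnion _ z).trans haV)
  obtain ⟨F, hF⟩ := exists_homeomorph_floor_glue h h1
  refine ⟨h₀.trans F, fun x hx => ?_, fun x hx => ?_⟩
  · rw [Homeomorph.trans_apply, h₀a x hx, hF]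
    obtain ⟨z, hz⟩ := Set.mem_iUnion.1 hx
    rw [floor_glue_eq (h := fun z => h z) h1 z (hAcube z hz)]
    exact h2 z x hz
  · rw [Homeomorph.trans_apply, hF]
    exact h3 _ _ ⟨⟨x, hx, rfl⟩, mem_latticeCube_floor _⟩

theorem exists_absorbsCountableClosed {ι : Type*} [Fintype ι] {a : Set (ι → ℝ)} (ha : a.Countable)
    (haC : IsClosed a) :
    ∃ a' : Set (ι → ℝ), a'.Countable ∧ IsClosed a' ∧ a ⊆ a' ∧ AbsorbsCountableClosed a' := by
  have hbad : (⋃ x ∈ a, ⋃ (i : ι), ⋃ (m : ℤ), {(m : ℝ) - x i}).Countable :=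
    ha.biUnion fun x _ => Set.countable_iUnion fun i => Set.countable_iUnion fun m =>
      Set.countable_singleton _
  obtain ⟨t, -, ht⟩ : ∃ t ∈ Set.Ioo (0 : ℝ) 1, t ∉ ⋃ x ∈ a, ⋃ (i : ι), ⋃ (m : ℤ),
      {(m : ℝ) - x i} := by
    by_contra! h
    exact absurd (Cardinal.Real.Ioo_countable_iff.1 (hbad.mono h)) (by norm_num)
  let e : (ι → ℝ) ≃ₜ (ι → ℝ) := Homeomorph.addRight fun _ => t
  obtain ⟨a', h1, h2, h3, h4⟩ := exists_absorbs_of_off_grid (a := e '' a) (ha.image e)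
    (e.isClosedMap a haC) (by
      rintro _ ⟨x, hx, rfl⟩ i m h
      apply ht
      simp only [Set.mem_iUnion, Set.mem_singleton_iff]
      refine ⟨x, hx, i, m, ?_⟩
      rw [← h]
      simp [e])
  exact ⟨e ⁻¹' a', h1.preimage e.injective, h2.preimage e.continuous, Set.image_subset_iff.1 h3,
    h4.preimage e⟩

/-- Tightness of ℝⁿ with the ideal generated by countable closed
sets. -/
theorem stmt10 (n : ℕ) (hn : 1 ≤ n)
    (a : Set (EuclideanSpace ℝ (Fin n)))
    (ha : a.Countable) (haC : IsClosed a) :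
    ∃ a' : Set (EuclideanSpace ℝ (Fin n)),
      a'.Countable ∧ IsClosed a' ∧ a ⊆ a' ∧
      ∀ b : Set (EuclideanSpace ℝ (Fin n)), b.Countable → IsClosed b →
        ∀ ε : ℝ, 0 < ε →
          ∃ h : EuclideanSpace ℝ (Fin n) ≃ₜ EuclideanSpace ℝ (Fin n),
            (∀ x ∈ a', h x = x) ∧ h '' b ⊆ Metric.thickening ε a' := by
  let e : EuclideanSpace ℝ (Fin n) ≃ₜ (Fin n → ℝ) := (EuclideanSpace.equiv (Fin n) ℝ).toHomeomorph
  obtain ⟨a', h1, h2, h3, h4⟩ := exists_absorbsCountableClosed (ha.image e) (e.isClosedMap a haC)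
  refine ⟨e ⁻¹' a', h1.preimage e.injective, h2.preimage e.continuous, Set.image_subset_iff.1 h3,
    fun b hb hbC ε hε => ?_⟩
  obtain ⟨h, hfix, hpush⟩ := h4.preimage e b hb hbC _ Metric.isOpen_thickening
    (Metric.self_subset_thickening hε _)
  exact ⟨h, hfix, Set.image_subset_iff.2 hpush⟩
end

section
/- Let X ⊆ ℝ² be the Cantor Set Iteration, with the subspace topology, and for each i ∈ ℕ let b_i denote the boundary of K_i in X, i.e., b_i = K_i ∩ closure_X(X ∖ K_i). Then for every sequence (h_i)_{i∈ℕ} of self-homeomorphisms of X, the closure in X of ⋃_{i∈ℕ} h_i '' b_i is not compact. -/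
/-- The Cantor set iteration stages on the line: `C 0 = [0,1]`,
`C (i+1) = (1/3)·C i ∪ (2/3 + (1/3)·C i)`. -/
def cantorIterC : ℕ → Set ℝ
  | 0 => Set.Icc 0 1
  | (i + 1) => (fun x : ℝ => x / 3) '' cantorIterC i ∪
      (fun x : ℝ => 2 / 3 + x / 3) '' cantorIterC i

/-- `K i = ⋃_{j ≤ i} C j × [j, j+1]`. -/
def cantorIterK (i : ℕ) : Set (ℝ × ℝ) :=
  ⋃ j ∈ Set.Iic i, cantorIterC j ×ˢ Set.Icc (j : ℝ) ((j : ℝ) + 1)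

/-- The Cantor Set Iteration `X = ⋃ i, K i`. -/
def cantorIterX : Set (ℝ × ℝ) := ⋃ i, cantorIterK i

/-- The boundary of `K i` in the subspace `X`:
`b i = K i ∩ closure_X (X ∖ K i)`. -/
def cantorIterB (i : ℕ) : Set ↥cantorIterX :=
  {p : ↥cantorIterX | (p : ℝ × ℝ) ∈ cantorIterK i} ∩
    closure {p : ↥cantorIterX | (p : ℝ × ℝ) ∉ cantorIterK i}

theorem cantorIterC_subset_Icc (n : ℕ) : cantorIterC n ⊆ Set.Icc 0 1 := by
  induction n with
  | zero => exact subset_rfl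
  | succ n ih =>
    rintro x (⟨y, hy, rfl⟩ | ⟨y, hy, rfl⟩) <;> obtain ⟨h0, h1⟩ := ih hy <;>
      constructor <;> dsimp only <;> linarith

theorem antitone_cantorIterC : Antitone cantorIterC := by
  refine antitone_nat_of_succ_le fun n => ?_
  induction n with
  | zero => exact cantorIterC_subset_Icc 1
  | succ n ih => exact Set.union_subset_union (Set.image_mono ih) (Set.image_mono ih)

theorem isCompact_cantorIterC (n : ℕ) : IsCompact (cantorIterC n) := by
  induction n with
  | zero => exact isCompact_Icc
  | succ n ih => exact (ih.image (by fun_prop)).union (ih.image (by fun_prop))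

theorem one_mem_cantorIterC (n : ℕ) : (1 : ℝ) ∈ cantorIterC n := by
  induction n with
  | zero => exact ⟨zero_le_one, le_rfl⟩
  | succ n ih => exact Or.inr ⟨1, ih, by norm_num⟩

theorem inv_three_pow_mem_cantorIterC (k n : ℕ) : ((3 : ℝ) ^ k)⁻¹ ∈ cantorIterC n := by
  induction k generalizing n with
  | zero => simpa using one_mem_cantorIterC n
  | succ k ih =>
    cases n with
    | zero => exact ⟨by positivity, inv_le_one_of_one_le₀ (one_le_pow₀ (by norm_num))⟩
    | succ n => exact Or.inl ⟨_, ih n, by simp only [pow_succ, mul_inv, div_eq_mul_inv]⟩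

/-- The midpoints of the gaps `(1 / 3 ^ (k + 1), 2 / 3 ^ (k + 1))` are removed at stage `k + 1`. -/
theorem half_inv_three_pow_notMem_cantorIterC {k n : ℕ} (hkn : k < n) :
    ((3 : ℝ) ^ k)⁻¹ / 2 ∉ cantorIterC n := by
  induction k generalizing n with
  | zero =>
    obtain ⟨n, rfl⟩ := Nat.exists_eq_add_of_lt hkn
    rintro (⟨y, hy, h⟩ | ⟨y, hy, h⟩) <;> have := cantorIterC_subset_Icc _ hy <;>
      norm_num at h this <;> linarith
  | succ k ih =>
    obtain ⟨n, rfl⟩ : ∃ m, n = m + 1 := ⟨n - 1, by omega⟩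
    rw [pow_succ, mul_inv]
    rintro (⟨y, hy, h⟩ | ⟨y, hy, h⟩)
    · refine ih (by omega : k < n) ?_
      dsimp only at h
      convert hy using 1
      linarith
    · have h0 := (cantorIterC_subset_Icc _ hy).1
      have h1 : ((3 : ℝ) ^ k)⁻¹ ≤ 1 := inv_le_one_of_one_le₀ (one_le_pow₀ (by norm_num))
      dsimp only at h
      linarith

theorem exists_finite_preconnected_cover_cantorIterC (n : ℕ) :
    ∃ F : Set (Set ℝ), F.Finite ∧ (∀ I ∈ F, IsPreconnected I) ∧ ⋃₀ F = cantorIterC n := by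
  induction n with
  | zero =>
    exact ⟨{Set.Icc 0 1}, Set.finite_singleton _, by simpa using isPreconnected_Icc,
      Set.sUnion_singleton _⟩
  | succ n ih =>
    obtain ⟨F, hF, hconn, hcover⟩ := ih
    refine ⟨(fun I => (fun x : ℝ => x / 3) '' I) '' F ∪
      (fun I => (fun x : ℝ => 2 / 3 + x / 3) '' I) '' F, (hF.image _).union (hF.image _), ?_, ?_⟩
    · rintro _ (⟨I, hI, rfl⟩ | ⟨I, hI, rfl⟩) <;>
        exact (hconn I hI).image _ (by fun_prop)
    · rw [Set.sUnion_union, cantorIterC, ← hcover, Set.sUnion_image, Set.sUnion_image,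
        Set.sUnion_eq_biUnion, Set.image_iUnion₂, Set.image_iUnion₂]

theorem mem_cantorIterK {i : ℕ} {p : ℝ × ℝ} :
    p ∈ cantorIterK i ↔ ∃ j ≤ i, p.1 ∈ cantorIterC j ∧ (j : ℝ) ≤ p.2 ∧ p.2 ≤ j + 1 := by
  simp only [cantorIterK, Set.mem_iUnion, Set.mem_Iic, Set.mem_prod, Set.mem_Icc, exists_prop]

theorem mem_cantorIterX {p : ℝ × ℝ} :
    p ∈ cantorIterX ↔ ∃ j : ℕ, p.1 ∈ cantorIterC j ∧ (j : ℝ) ≤ p.2 ∧ p.2 ≤ j + 1 := by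
  simp only [cantorIterX, Set.mem_iUnion, mem_cantorIterK]
  exact ⟨fun ⟨_, j, _, h⟩ => ⟨j, h⟩, fun ⟨j, h⟩ => ⟨j, j, le_rfl, h⟩⟩

theorem isCompact_cantorIterK (i : ℕ) : IsCompact (cantorIterK i) :=
  (Set.finite_Iic i).isCompact_biUnion fun j _ => (isCompact_cantorIterC j).prod isCompact_Icc

theorem mem_cantorIterK_iff_snd_le {i : ℕ} {p : ℝ × ℝ} (hp : p ∈ cantorIterX) :
    p ∈ cantorIterK i ↔ p.2 ≤ i + 1 := by
  rw [mem_cantorIterK]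
  constructor
  · rintro ⟨j, hj, -, -, h⟩
    have : (j : ℝ) ≤ i := by exact_mod_cast hj
    linarith
  · intro h
    obtain ⟨j, hC, h0, h1⟩ := mem_cantorIterX.1 hp
    rcases le_or_gt j i with hji | hji
    · exact ⟨j, hji, hC, h0, h1⟩
    · have : (i : ℝ) + 1 ≤ j := by exact_mod_cast hji
      exact ⟨i, le_rfl, antitone_cantorIterC hji.le hC, by linarith, h⟩

theorem fst_mem_cantorIterC_of_lt_snd {n : ℕ} {p : ℝ × ℝ} (hp : p ∈ cantorIterX)
    (h : (n : ℝ) < p.2) : p.1 ∈ cantorIterC n := by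
  obtain ⟨j, hC, -, h1⟩ := mem_cantorIterX.1 hp
  have : n < j + 1 := by exact_mod_cast h.trans_le h1
  exact antitone_cantorIterC (by omega) hC

theorem mk_mem_cantorIterX {j : ℕ} {x y : ℝ} (hx : x ∈ cantorIterC j) (h0 : 0 ≤ y)
    (h1 : y ≤ j + 1) : (x, y) ∈ cantorIterX := by
  rw [mem_cantorIterX]
  rcases le_or_gt (j : ℝ) y with hjy | hjy
  · exact ⟨j, hx, hjy, h1⟩
  · exact ⟨⌊y⌋₊, antitone_cantorIterC (Nat.floor_le_of_le hjy.le) hx, Nat.floor_le h0,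
      (Nat.lt_floor_add_one y).le⟩

/-- The part of the Cantor set iteration above height `n` over a preconnected subset of stage `n`
is preconnected. -/
theorem isPreconnected_cantorIterX_above {n : ℕ} {I : Set ℝ} (hI : IsPreconnected I)
    (hIC : I ⊆ cantorIterC n) :
    IsPreconnected {p : ↥cantorIterX | (n : ℝ) < (p : ℝ × ℝ).2 ∧ (p : ℝ × ℝ).1 ∈ I} := by
  rw [← Topology.IsInducing.subtypeVal.isPreconnected_image]
  rcases I.eq_empty_or_nonempty with rfl | ⟨x₀, hx₀⟩
  · simpa using isPreconnected_empty
  refine isPreconnected_of_forall (x₀, (n : ℝ) + 1 / 2) ?_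
  rintro _ ⟨⟨⟨x, y⟩, hp⟩, ⟨hy, hx⟩, rfl⟩
  dsimp only at hx hy
  refine ⟨({x} ×ˢ Set.uIcc y ((n : ℝ) + 1 / 2)) ∪ (I ×ˢ {(n : ℝ) + 1 / 2}), ?_,
    Or.inr ⟨hx₀, rfl⟩, Or.inl ⟨rfl, Set.left_mem_uIcc⟩, ?_⟩
  · have hn : (0 : ℝ) ≤ n := n.cast_nonneg
    rintro ⟨u, v⟩ (⟨rfl, hv⟩ | ⟨hu, rfl⟩)
    · obtain ⟨j, hC, -, h1⟩ := mem_cantorIterX.1 hp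
      dsimp only at hC h1 hv
      have hnj : n < j + 1 := by exact_mod_cast hy.trans_le h1
      have hnj' : (n : ℝ) ≤ j := by exact_mod_cast Nat.lt_succ_iff.1 hnj
      rw [Set.mem_uIcc] at hv
      have hnv : (n : ℝ) < v := by rcases hv with hv | hv <;> linarith
      exact ⟨⟨(u, v), mk_mem_cantorIterX hC (by linarith)
        (by rcases hv with hv | hv <;> linarith)⟩, ⟨hnv, hx⟩, rfl⟩
    · exact ⟨⟨(u, (n : ℝ) + 1 / 2), mk_mem_cantorIterX (hIC hu) (by linarith) (by linarith)⟩,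
        ⟨by dsimp only; linarith, hu⟩, rfl⟩
  · exact (isPreconnected_singleton.prod isPreconnected_uIcc).union (x, (n : ℝ) + 1 / 2)
      ⟨rfl, Set.right_mem_uIcc⟩ ⟨hx, rfl⟩ (hI.prod isPreconnected_singleton)

/-- The part of the Cantor set iteration above height `i + 1` lying strictly between the gap
midpoints `1 / (2 * 3 ^ (k + 1))` and `1 / (2 * 3 ^ k)`. -/
def cantorIterBranch (i k : ℕ) : Set ↥cantorIterX :=
  {p | (i : ℝ) + 1 < (p : ℝ × ℝ).2 ∧ ((3 : ℝ) ^ (k + 1))⁻¹ / 2 < (p : ℝ × ℝ).1 ∧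
    (p : ℝ × ℝ).1 < ((3 : ℝ) ^ k)⁻¹ / 2}

theorem isOpen_cantorIterBranch (i k : ℕ) : IsOpen (cantorIterBranch i k) :=
  have h₁ : Continuous fun p : ↥cantorIterX => (p : ℝ × ℝ).1 := by fun_prop
  have h₂ : Continuous fun p : ↥cantorIterX => (p : ℝ × ℝ).2 := by fun_prop
  (isOpen_lt continuous_const h₂).and
    ((isOpen_lt continuous_const h₁).and (isOpen_lt h₁ continuous_const))

theorem closure_cantorIterBranch_subset {i k : ℕ} (hk : k < i) :
    closure (cantorIterBranch i k) ⊆ cantorIterBranch i k ∪ cantorIterB i := by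
  intro p hp
  have hclosed : p ∈ {p : ↥cantorIterX | (i : ℝ) + 1 ≤ (p : ℝ × ℝ).2 ∧
      ((3 : ℝ) ^ (k + 1))⁻¹ / 2 ≤ (p : ℝ × ℝ).1 ∧ (p : ℝ × ℝ).1 ≤ ((3 : ℝ) ^ k)⁻¹ / 2} := by
    have h₁ : Continuous fun p : ↥cantorIterX => (p : ℝ × ℝ).1 := by fun_prop
    have h₂ : Continuous fun p : ↥cantorIterX => (p : ℝ × ℝ).2 := by fun_prop
    refine closure_minimal ?_ ?_ hp
    · exact fun q hq => ⟨hq.1.le, hq.2.1.le, hq.2.2.le⟩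
    · exact (isClosed_le continuous_const h₂).inter
        ((isClosed_le continuous_const h₁).inter (isClosed_le h₁ continuous_const))
  obtain ⟨h1, h2, h3⟩ := hclosed
  rcases h1.lt_or_eq with h1 | h1
  · have hC : (p : ℝ × ℝ).1 ∈ cantorIterC (i + 1) :=
      fst_mem_cantorIterC_of_lt_snd p.2 (by exact_mod_cast h1)
    refine Or.inl ⟨h1, h2.lt_of_ne ?_, h3.lt_of_ne ?_⟩
    · intro h
      exact half_inv_three_pow_notMem_cantorIterC (by omega) (h ▸ hC)
    · intro h
      exact half_inv_three_pow_notMem_cantorIterC (by omega) (h ▸ hC)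
  · refine Or.inr ⟨(mem_cantorIterK_iff_snd_le p.2).2 h1.ge, closure_mono ?_ hp⟩
    intro q hq hqK
    exact hq.1.not_ge ((mem_cantorIterK_iff_snd_le q.2).1 hqK)

theorem eq_of_mem_cantorIterBranch {i k l : ℕ} {p : ↥cantorIterX}
    (hk : p ∈ cantorIterBranch i k) (hl : p ∈ cantorIterBranch i l) : k = l := by
  have key : ∀ {k l : ℕ}, p ∈ cantorIterBranch i k → p ∈ cantorIterBranch i l → ¬ k < l := by
    intro k l hk hl hkl
    have : ((3 : ℝ) ^ l)⁻¹ ≤ ((3 : ℝ) ^ (k + 1))⁻¹ :=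
      inv_anti₀ (by positivity) (pow_le_pow_right₀ (by norm_num) hkl)
    linarith [hk.2.1, hl.2.2]
  exact le_antisymm (not_lt.1 (key hl hk)) (not_lt.1 (key hk hl))

theorem exists_nat_snd_le_of_isCompact {S : Set ↥cantorIterX} (hS : IsCompact S) :
    ∃ n : ℕ, ∀ p ∈ S, (p : ℝ × ℝ).2 ≤ n := by
  obtain ⟨M, hM⟩ := hS.bddAbove_image (f := fun p : ↥cantorIterX => (p : ℝ × ℝ).2) (by fun_prop)
  obtain ⟨n, hn⟩ := exists_nat_ge M
  exact ⟨n, fun p hp => (hM ⟨p, hp, rfl⟩).trans hn⟩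

theorem not_cantorIterBranch_subset_of_isCompact (i k : ℕ) {S : Set ↥cantorIterX}
    (hS : IsCompact S) : ¬ cantorIterBranch i k ⊆ S := by
  intro hsub
  obtain ⟨n, hn⟩ := exists_nat_snd_le_of_isCompact hS
  have hi : (0 : ℝ) ≤ i := i.cast_nonneg
  have hn0 : (0 : ℝ) ≤ n := n.cast_nonneg
  have hmem : (((3 : ℝ) ^ (k + 1))⁻¹, (i : ℝ) + n + 2) ∈ cantorIterX :=
    mk_mem_cantorIterX (inv_three_pow_mem_cantorIterC (k + 1) (i + n + 1)) (by positivity)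
      (by push_cast; linarith)
  have hpos : (0 : ℝ) < ((3 : ℝ) ^ k)⁻¹ := by positivity
  have := hn ⟨_, hmem⟩ (hsub ⟨by dsimp only; linarith,
    by dsimp only; rw [pow_succ, mul_inv]; linarith,
    by dsimp only; rw [pow_succ, mul_inv]; linarith⟩)
  dsimp only at this
  linarith

/-- For any sequence of self-homeomorphisms `h i` of the
Cantor Set Iteration `X`, the closure of `⋃ i, h i '' b i` in `X` is not
compact. -/
theorem stmt13 (h : ℕ → (↥cantorIterX ≃ₜ ↥cantorIterX)) :
    ¬ IsCompact (closure (⋃ i, (h i) '' (cantorIterB i))) := by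
  intro hcompact
  obtain ⟨n, hn⟩ := exists_nat_snd_le_of_isCompact hcompact
  obtain ⟨F, hF, hconn, hcover⟩ := exists_finite_preconnected_cover_cantorIterC n
  have := hF.to_subtype
  have := Fintype.ofFinite F
  set i := Fintype.card F + 1
  have hK : IsCompact {p : ↥cantorIterX | (p : ℝ × ℝ) ∈ cantorIterK n} := by
    rw [Topology.IsInducing.subtypeVal.isCompact_iff]
    have himage : ((↑) : ↥cantorIterX → ℝ × ℝ) '' {p | (p : ℝ × ℝ) ∈ cantorIterK n} =
        cantorIterK n := by
      refine Subtype.coe_image_of_subset ?_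
      exact Set.subset_iUnion cantorIterK n
    rw [himage]
    exact isCompact_cantorIterK n
  have hmeet : ∀ k : Fin i, ∃ I : F, ∃ p : ↥cantorIterX, ((n : ℝ) < (p : ℝ × ℝ).2 ∧
      (p : ℝ × ℝ).1 ∈ (I : Set ℝ)) ∧ (h i).symm p ∈ cantorIterBranch i k := by
    intro k
    obtain ⟨q, hq, hqK⟩ := Set.not_subset.1 (not_cantorIterBranch_subset_of_isCompact i k
      ((h i).isCompact_preimage.2 hK))
    have hlt : (n : ℝ) < (h i q : ℝ × ℝ).2 := by
      have := not_le.1 (mt (mem_cantorIterK_iff_snd_le (h i q).2).2 hqK)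
      linarith
    have hC := fst_mem_cantorIterC_of_lt_snd (h i q).2 hlt
    rw [← hcover] at hC
    obtain ⟨I, hI, hmem⟩ := hC
    exact ⟨⟨I, hI⟩, h i q, ⟨hlt, hmem⟩, by simpa using hq⟩
  choose I p hp hpk using hmeet
  have hsub : ∀ k : Fin i, {p : ↥cantorIterX | (n : ℝ) < (p : ℝ × ℝ).2 ∧
      (p : ℝ × ℝ).1 ∈ (I k : Set ℝ)} ⊆ (h i).symm ⁻¹' cantorIterBranch i k := by
    intro k
    refine (isPreconnected_cantorIterX_above (hconn _ (I k).2)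
      (hcover ▸ Set.subset_sUnion_of_mem (I k).2)).subset_of_closure_inter_subset
      ((isOpen_cantorIterBranch i k).preimage (h i).symm.continuous) ⟨p k, hp k, hpk k⟩ ?_
    rintro q ⟨hq, hqn, -⟩
    rw [← (h i).symm.preimage_closure] at hq
    refine (closure_cantorIterBranch_subset k.2 hq).resolve_right fun hqB => ?_
    refine hqn.not_ge (hn q (subset_closure (Set.mem_iUnion.2 ⟨i, _, hqB, ?_⟩)))
    simp
  have hinj : Function.Injective I := by
    intro k l hkl
    refine Fin.ext (eq_of_mem_cantorIterBranch (hpk k) (hsub l ?_))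
    rw [← hkl]
    exact hp k
  have hcard := Fintype.card_le_of_injective I hinj
  rw [Fintype.card_fin] at hcard
  omega
end

section
/- Let a be a closed subset of the Cantor space 2^ω, and let c and d be nonempty perfect (closed with no isolated points) nowhere dense subsets of 2^ω with a ⊆ c and a ⊆ d, such that a is nowhere dense in the subspace c and nowhere dense in the subspace d. Then there exists a self-homeomorphism h of 2^ω with h x = x for all x ∈ a and h '' d = c. -/
open Set Topology

section BackAndForth

variable {X : Type*} {a c d A B U : Set X}

/-- Two sets `A`, `B` look alike relative to the pairs `(c, a)` and `(d, a)`: they are simultaneously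
nonempty, `A` meets `c` iff `B` meets `d`, and they have the same trace on `a`. -/
structure SimilarTrace (a c d A B : Set X) : Prop where
  nonempty_iff : A.Nonempty ↔ B.Nonempty
  inter_nonempty_iff : (A ∩ c).Nonempty ↔ (B ∩ d).Nonempty
  mem_iff : ∀ x ∈ a, (x ∈ A ↔ x ∈ B)

lemma SimilarTrace.symm (h : SimilarTrace a c d A B) : SimilarTrace a d c B A :=
  ⟨h.nonempty_iff.symm, h.inter_nonempty_iff.symm, fun x hx => (h.mem_iff x hx).symm⟩

lemma SimilarTrace.of_inter_nonempty (hA : (A ∩ c).Nonempty) (hB : (B ∩ d).Nonempty)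
    (h : ∀ x ∈ a, (x ∈ A ↔ x ∈ B)) : SimilarTrace a c d A B :=
  ⟨iff_of_true hA.left hB.left, iff_of_true hA hB, h⟩

lemma SimilarTrace.of_inter_eq_empty (hA : A.Nonempty) (hB : B.Nonempty) (hac : a ⊆ c) (had : a ⊆ d)
    (hAc : A ∩ c = ∅) (hBd : B ∩ d = ∅) : SimilarTrace a c d A B := by
  refine ⟨iff_of_true hA hB, by simp [hAc, hBd], fun x hx => iff_of_false (fun h => ?_) fun h => ?_⟩
  · exact (hAc ▸ ⟨h, hac hx⟩ : x ∈ (∅ : Set X))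
  · exact (hBd ▸ ⟨h, had hx⟩ : x ∈ (∅ : Set X))

variable [TopologicalSpace X]

lemma Preperfect.exists_ne_of_isOpen {S : Set X} (hS : Preperfect S) (hU : IsOpen U)
    (h : (U ∩ S).Nonempty) : ∃ x ∈ U ∩ S, ∃ y ∈ U ∩ S, x ≠ y := by
  obtain ⟨x, hxU, hxS⟩ := h
  obtain ⟨y, hy, hne⟩ := preperfect_iff_nhds.1 hS x hxS U (hU.mem_nhds hxU)
  exact ⟨x, ⟨hxU, hxS⟩, y, hy, hne.symm⟩

/-- `d` is a perfect nowhere dense set in which the closed set `a` is nowhere dense. -/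
structure IsNowhereDensePerfectPair (a d : Set X) : Prop where
  isClosed : IsClosed a
  subset : a ⊆ d
  perfect : Perfect d
  diff_nonempty : ∀ U : Set X, IsOpen U → U.Nonempty → (U \ d).Nonempty
  inter_diff_nonempty : ∀ U : Set X, IsOpen U → (U ∩ d).Nonempty → (U \ a ∩ d).Nonempty

lemma IsNowhereDensePerfectPair.of_interior_eq_empty (ha : IsClosed a) (had : a ⊆ d)
    (hd : Perfect d) (hdN : IsNowhereDense d)
    (hadN : interior {x : ↥d | (x : X) ∈ a} = ∅) : IsNowhereDensePerfectPair a d where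
  isClosed := ha
  subset := had
  perfect := hd
  diff_nonempty U hU hne := by
    by_contra h
    rw [not_nonempty_iff_eq_empty, sdiff_eq_empty] at h
    have := interior_maximal (h.trans subset_closure) hU
    rw [hdN] at this
    exact hne.ne_empty (subset_empty_iff.1 this)
  inter_diff_nonempty U hU hne := by
    obtain ⟨x, hxU, hxd⟩ := hne
    by_contra h
    have hsub : ((↑) : d → X) ⁻¹' U ⊆ {x : ↥d | (x : X) ∈ a} := fun y hy => by
      by_contra hya
      exact h ⟨y, ⟨hy, hya⟩, y.2⟩
    have hx := interior_maximal hsub (hU.preimage continuous_subtype_val)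
      (show (⟨x, hxd⟩ : d) ∈ _ from hxU)
    rw [hadN] at hx
    exact hx

/-- Two locally constant labellings whose fibres over each label look alike. -/
structure SimilarLabelling (a c d : Set X) (p q : X → ℕ) : Prop where
  left : IsLocallyConstant p
  right : IsLocallyConstant q
  similarTrace : ∀ n, SimilarTrace a c d (p ⁻¹' {n}) (q ⁻¹' {n})

lemma SimilarLabelling.symm {p q : X → ℕ} (h : SimilarLabelling a c d p q) :
    SimilarLabelling a d c q p :=
  ⟨h.right, h.left, fun n => (h.similarTrace n).symm⟩

lemma IsLocallyConstant.bit {u : X → Bool} {p : X → ℕ}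
    (hu : IsLocallyConstant u) (hp : IsLocallyConstant p) :
    IsLocallyConstant fun x => Nat.bit (u x) (p x) :=
  hu.comp₂ hp Nat.bit

lemma bit_eq_bit_iff {b b' : Bool} {m n : ℕ} : Nat.bit b m = Nat.bit b' n ↔ b = b' ∧ m = n := by
  refine ⟨fun h => ⟨?_, ?_⟩, fun ⟨hb, hn⟩ => by rw [hb, hn]⟩
  · simpa using congrArg Nat.bodd h
  · simpa using congrArg Nat.div2 h

lemma preimage_bit_singleton {α : Type*} (u : α → Bool) (p : α → ℕ) (n : ℕ) :
    (fun x => Nat.bit (u x) (p x)) ⁻¹' {n} = p ⁻¹' {n.div2} ∩ u ⁻¹' {n.bodd} := by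
  ext x
  simp only [mem_preimage, mem_singleton_iff, mem_inter_iff]
  refine ⟨?_, ?_⟩
  · rintro rfl; simp
  · rintro ⟨h1, h2⟩; rw [h1, h2, Nat.bit_bodd_div2]

lemma exists_forall_label_eq [CompactSpace X] {P Q : ℕ → X → ℕ} (hQ : ∀ n, IsLocallyConstant (Q n))
    (hPQ : ∀ n x y, P (n + 1) x = Q (n + 1) y → P n x = Q n y) {L : Set X} (hL : IsClosed L) (x : X)
    (h : ∀ n, (Q n ⁻¹' {P n x} ∩ L).Nonempty) : ∃ y ∈ L, ∀ n, P n x = Q n y := by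
  have hcl : ∀ n, IsClosed (Q n ⁻¹' {P n x} ∩ L) := fun n =>
    ((hQ n).isClosed_fiber (P n x)).inter hL
  obtain ⟨y, hy⟩ := IsCompact.nonempty_iInter_of_sequence_nonempty_isCompact_isClosed
    (fun n => Q n ⁻¹' {P n x} ∩ L)
    (fun n y hy => ⟨(hPQ n x y hy.1.symm).symm, hy.2⟩) h (hcl 0).isCompact hcl
  rw [mem_iInter] at hy
  exact ⟨y, (hy 0).2, fun n => (hy n).1.symm⟩

variable [CompactSpace X] [T2Space X] [TotallyDisconnectedSpace X]

lemma exists_isClopen_of_disjoint {Z W : Set X} (hZ : IsClosed Z) (hW : IsClosed W)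
    (h : Disjoint Z W) : ∃ V : Set X, IsClopen V ∧ Z ⊆ V ∧ Disjoint V W := by
  obtain ⟨V, hV, hZV, hVW⟩ :=
    exists_clopen_of_closed_subset_open hZ hW.isOpen_compl h.subset_compl_right
  exact ⟨V, hV, hZV, disjoint_left.2 fun x hx => hVW hx⟩

lemma SimilarTrace.exists_split_of_inter_eq_empty (hac : a ⊆ c) (hd : IsNowhereDensePerfectPair a d)
    (hB : IsClopen B) (h : SimilarTrace a c d A B) (hU : (A ∩ U).Nonempty)
    (hUc : A ∩ U ∩ c = ∅) (hU' : (A ∩ Uᶜ ∩ c).Nonempty) :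
    ∃ V : Set X, IsClopen V ∧ SimilarTrace a c d (A ∩ U) (B ∩ V) ∧
      SimilarTrace a c d (A ∩ Uᶜ) (B ∩ Vᶜ) := by
  obtain ⟨x, hxB, hxd⟩ := hd.diff_nonempty B hB.isOpen (h.nonempty_iff.1 hU.left)
  obtain ⟨V, hV, hxV, hVB⟩ := compact_exists_isClopen_in_isOpen
    (hB.isOpen.sdiff hd.perfect.closed) (show x ∈ B \ d from ⟨hxB, hxd⟩)
  obtain ⟨z, hzB, hzd⟩ := h.inter_nonempty_iff.1 (hU'.mono (by grind))
  refine ⟨V, hV, .of_inter_eq_empty hU ⟨x, hxB, hxV⟩ hac hd.subset hUc (by grind),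
    .of_inter_nonempty hU' ⟨z, ⟨hzB, fun hz => (hVB hz).2 hzd⟩, hzd⟩ fun y hy => ?_⟩
  have hyU : y ∈ A → y ∉ U := fun h1 h2 => (hUc ▸ ⟨⟨h1, h2⟩, hac hy⟩ : y ∈ (∅ : Set X))
  have hyV : y ∉ V := fun h1 => (hVB h1).2 (hd.subset hy)
  have := h.mem_iff y hy
  simp only [mem_inter_iff, mem_compl_iff]
  tauto

/-- If `A` and `B` look alike, any clopen splitting of `A` is matched by one of `B`. -/
lemma SimilarTrace.exists_split [PerfectSpace X] (hac : a ⊆ c) (hd : IsNowhereDensePerfectPair a d)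
    (hB : IsClopen B) (h : SimilarTrace a c d A B) (hA : IsClopen A) (hU : IsClopen U) :
    ∃ V : Set X, IsClopen V ∧ SimilarTrace a c d (A ∩ U) (B ∩ V) ∧
      SimilarTrace a c d (A ∩ Uᶜ) (B ∩ Vᶜ) := by
  have had := hd.subset
  rcases (A ∩ U).eq_empty_or_nonempty with hAU | hAU
  · have hAU' : A ∩ Uᶜ = A := by rwa [← sdiff_eq, sdiff_eq_left, disjoint_iff_inter_eq_empty]
    exact ⟨∅, isClopen_empty, by rw [hAU, inter_empty]; exact ⟨by simp, by simp, by simp⟩,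
      by rwa [hAU', compl_empty, inter_univ]⟩
  rcases (A ∩ Uᶜ).eq_empty_or_nonempty with hAU' | hAU'
  · have hAU'' : A ∩ U = A := by rwa [inter_eq_left, ← sdiff_eq_empty, sdiff_eq]
    exact ⟨univ, isClopen_univ, by rwa [hAU'', inter_univ],
      by rw [hAU', compl_univ, inter_empty]; exact ⟨by simp, by simp, by simp⟩⟩
  rcases (A ∩ U ∩ c).eq_empty_or_nonempty with hc | hc <;>
  rcases (A ∩ Uᶜ ∩ c).eq_empty_or_nonempty with hc' | hc'
  · have hAc : ¬ (A ∩ c).Nonempty := by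
      rw [not_nonempty_iff_eq_empty]; grind
    rw [h.inter_nonempty_iff, not_nonempty_iff_eq_empty] at hAc
    obtain ⟨x, ⟨hx, -⟩, y, ⟨hy, -⟩, hxy⟩ := PerfectSpace.univ_preperfect.exists_ne_of_isOpen
      hB.isOpen (by simpa using h.nonempty_iff.1 hAU.left)
    obtain ⟨V, hV, hxV, hVy⟩ := exists_isClopen_of_disjoint isClosed_singleton isClosed_singleton
      (disjoint_singleton.2 hxy)
    rw [singleton_subset_iff] at hxV
    rw [disjoint_singleton_right] at hVy
    exact ⟨V, hV, .of_inter_eq_empty hAU ⟨x, hx, hxV⟩ hac had hc (by grind),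
      .of_inter_eq_empty hAU' ⟨y, hy, hVy⟩ hac had hc' (by grind)⟩
  · exact h.exists_split_of_inter_eq_empty hac hd hB hAU hc hc'
  · obtain ⟨V, hV, h1, h2⟩ := h.exists_split_of_inter_eq_empty (U := Uᶜ) hac hd hB hAU' hc'
      (by rwa [compl_compl])
    exact ⟨Vᶜ, hV.compl, by rwa [compl_compl] at h2, by rwa [compl_compl]⟩
  · obtain ⟨x, ⟨⟨hxB, hxa⟩, hxd⟩, y, ⟨⟨hyB, hya⟩, hyd⟩, hxy⟩ :=
      hd.perfect.acc.exists_ne_of_isOpen (hB.isOpen.sdiff hd.isClosed)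
        (hd.inter_diff_nonempty B hB.isOpen (h.inter_nonempty_iff.1 (hc.mono (by grind))))
    obtain ⟨V, hV, hZV, hVW⟩ := exists_isClopen_of_disjoint (Z := insert x (A ∩ U ∩ a))
      (W := insert y (A ∩ Uᶜ ∩ a))
      (by simpa only [insert_eq] using
        isClosed_singleton.union ((hA.inter hU).isClosed.inter hd.isClosed))
      (by simpa only [insert_eq] using
        isClosed_singleton.union ((hA.inter hU.compl).isClosed.inter hd.isClosed))
      (by rw [disjoint_left]; grind)
    rw [disjoint_left] at hVW
    refine ⟨V, hV, .of_inter_nonempty hc ⟨x, ⟨hxB, hZV (by simp)⟩, hxd⟩ fun z hz => ?_,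
      .of_inter_nonempty hc' ⟨y, ⟨hyB, fun hy => hVW hy (by simp)⟩, hyd⟩ fun z hz => ?_⟩ <;>
    · have h1 := h.mem_iff z hz
      have h2 := @hZV z
      have h3 := @hVW z
      grind

lemma SimilarLabelling.exists_bit [PerfectSpace X] (hac : a ⊆ c)
    (hd : IsNowhereDensePerfectPair a d) {p q : X → ℕ} (h : SimilarLabelling a c d p q)
    {u : X → Bool} (hu : IsLocallyConstant u) :
    ∃ v : X → Bool, SimilarLabelling a c d (fun x => Nat.bit (u x) (p x))
      fun x => Nat.bit (v x) (q x) := by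
  classical
  choose V hV h1 h2 using fun n => (h.similarTrace n).exists_split hac hd
    (h.right.isClopen_fiber n) (h.left.isClopen_fiber n) (hu.isClopen_fiber true)
  have hv : IsLocallyConstant fun x => decide (x ∈ V (q x)) := by
    rw [IsLocallyConstant.iff_eventually_eq]
    intro x
    have hVx : ∀ᶠ y in 𝓝 x, (y ∈ V (q x) ↔ x ∈ V (q x)) := by
      by_cases hx : x ∈ V (q x)
      · filter_upwards [(hV (q x)).isOpen.mem_nhds hx] with y hy
        simp [hy, hx]
      · filter_upwards [(hV (q x)).compl.isOpen.mem_nhds hx] with y hy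
        exact iff_of_false hy hx
    filter_upwards [hVx, h.right.eventually_eq x] with y hy hqy
    simp only [hqy, hy]
  refine ⟨_, hu.bit h.left, hv.bit h.right, fun n => ?_⟩
  rw [preimage_bit_singleton, preimage_bit_singleton]
  cases n.bodd
  · convert h2 n.div2 using 1
    · ext x; simp
    · ext x; simp +contextual
  · convert h1 n.div2 using 1
    · ext x; simp
    · ext x; simp +contextual

lemma SimilarLabelling.exists_refine [PerfectSpace X] (hc : IsNowhereDensePerfectPair a c)
    (hd : IsNowhereDensePerfectPair a d) {p q : X → ℕ} (h : SimilarLabelling a c d p q)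
    {u : X → Bool} (hu : IsLocallyConstant u) :
    ∃ p' q' : X → ℕ, SimilarLabelling a c d p' q' ∧
      (∀ x y, p' x = p' y → u x = u y) ∧ (∀ x y, q' x = q' y → u x = u y) ∧
      ∀ x y, p' x = q' y → p x = q y := by
  obtain ⟨v, hv⟩ := h.exists_bit hc.subset hd hu
  obtain ⟨w, hw⟩ := hv.symm.exists_bit hd.subset hc hu
  refine ⟨_, _, hw.symm, fun x y hxy => ?_, fun x y hxy => ?_, fun x y hxy => ?_⟩ <;>
  · grind [bit_eq_bit_iff]

/-- A Knaster–Reichbach type extension theorem. -/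
theorem IsNowhereDensePerfectPair.exists_homeomorph_image_eq [PerfectSpace X]
    (hc : IsNowhereDensePerfectPair a c)
    (hd : IsNowhereDensePerfectPair a d) (hcd : c.Nonempty ↔ d.Nonempty) {u : ℕ → X → Bool}
    (hu : ∀ n, IsLocallyConstant (u n)) (hsep : ∀ x y, (∀ n, u n x = u n y) → x = y) :
    ∃ h : X ≃ₜ X, (∀ x ∈ a, h x = x) ∧ h '' d = c := by
  have h0 : SimilarLabelling a c d (fun _ => 0) (fun _ => 0) := by
    refine ⟨.const 0, .const 0, fun n => ?_⟩
    by_cases hn : 0 = n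
    · simpa [hn] using (⟨Iff.rfl, by simpa using hcd, by simp⟩ : SimilarTrace a c d univ univ)
    · simpa [hn] using (⟨Iff.rfl, by simp, by simp⟩ : SimilarTrace a c d ∅ ∅)
  choose p' q' h1 h2 h3 h4 using fun (s : {s : (X → ℕ) × (X → ℕ) // SimilarLabelling a c d s.1 s.2})
    n => s.2.exists_refine hc hd (hu n)
  let S : ℕ → {s : (X → ℕ) × (X → ℕ) // SimilarLabelling a c d s.1 s.2} :=
    Nat.rec ⟨(fun _ => 0, fun _ => 0), h0⟩ fun n s => ⟨(p' s n, q' s n), h1 s n⟩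
  let P : ℕ → X → ℕ := fun n => (S n).1.1
  let Q : ℕ → X → ℕ := fun n => (S n).1.2
  have hS : ∀ n, SimilarLabelling a c d (P n) (Q n) := fun n => (S n).2
  have hPQ : ∀ n x y, P (n + 1) x = Q (n + 1) y → P n x = Q n y := fun n => h4 (S n) n
  have hPc : Continuous fun x n => P n x := continuous_pi fun n => (hS n).left.continuous
  have hQc : Continuous fun x n => Q n x := continuous_pi fun n => (hS n).right.continuous
  have hPi : Function.Injective fun x n => P n x := fun x y hxy =>
    hsep x y fun n => h2 (S n) n x y (congrFun hxy (n + 1))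
  have hQi : Function.Injective fun x n => Q n x := fun x y hxy =>
    hsep x y fun n => h3 (S n) n x y (congrFun hxy (n + 1))
  have hPe := (hPc.isClosedEmbedding hPi).isEmbedding
  have hQe := (hQc.isClosedEmbedding hQi).isEmbedding
  have hright : ∀ x, ∃ y, ∀ n, P n x = Q n y := fun x => by
    simpa using exists_forall_label_eq (fun n => (hS n).right) hPQ isClosed_univ x fun n => by
      simpa using ((hS n).similarTrace (P n x)).nonempty_iff.1 ⟨x, rfl⟩
  have hQP : ∀ n x y, Q (n + 1) x = P (n + 1) y → Q n x = P n y := fun n x y h =>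
    (hPQ n y x h.symm).symm
  have hleft : ∀ y, ∃ x, ∀ n, Q n y = P n x := fun y => by
    simpa using exists_forall_label_eq (fun n => (hS n).left) hQP isClosed_univ y fun n => by
      simpa using ((hS n).similarTrace (Q n y)).nonempty_iff.2 ⟨y, rfl⟩
  have hrange : range (fun x n => Q n x) = range fun x n => P n x := by
    refine Subset.antisymm ?_ ?_
    · rintro _ ⟨y, rfl⟩
      obtain ⟨x, hx⟩ := hleft y
      exact ⟨x, funext fun n => (hx n).symm⟩
    · rintro _ ⟨x, rfl⟩
      obtain ⟨y, hy⟩ := hright x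
      exact ⟨y, funext fun n => (hy n).symm⟩
  let h : X ≃ₜ X :=
    (hQe.toHomeomorph.trans (Homeomorph.setCongr hrange)).trans hPe.toHomeomorph.symm
  have hh : ∀ y n, P n (h y) = Q n y := fun y n =>
    congrFun (congrArg Subtype.val (hPe.toHomeomorph.apply_symm_apply
      (Homeomorph.setCongr hrange (hQe.toHomeomorph y)))) n
  have huniq : ∀ x y, (∀ n, P n x = Q n y) → h y = x := fun x y hxy =>
    hPi (funext fun n => (hh y n).trans (hxy n).symm)
  refine ⟨h, fun x hx => huniq x x fun n => ?_, Subset.antisymm ?_ fun x hx => ?_⟩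
  · exact (((hS n).similarTrace (P n x)).mem_iff x hx).1 rfl |>.symm
  · rintro _ ⟨y, hy, rfl⟩
    obtain ⟨x, hx, hxy⟩ := exists_forall_label_eq (fun n => (hS n).left) hQP hc.perfect.closed y
      fun n => ((hS n).similarTrace (Q n y)).inter_nonempty_iff.2 ⟨y, rfl, hy⟩
    rwa [huniq x y fun n => (hxy n).symm]
  · obtain ⟨y, hy, hxy⟩ := exists_forall_label_eq (fun n => (hS n).right) hPQ hd.perfect.closed x
      fun n => ((hS n).similarTrace (P n x)).inter_nonempty_iff.1 ⟨x, rfl, hx⟩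
    exact ⟨y, hy, huniq x y hxy⟩

end BackAndForth

instance perfectSpace_cantor : PerfectSpace (ℕ → Bool) := by
  refine ⟨preperfect_iff_nhds.2 fun x _ U hU => ?_⟩
  obtain ⟨V, hVU, hV, hxV⟩ := mem_nhds_iff.1 hU
  obtain ⟨I, W, hW, hIV⟩ := isOpen_pi_iff.1 hV x hxV
  obtain ⟨n, hn⟩ := Infinite.exists_notMem_finset I
  refine ⟨Function.update x n (!x n), ⟨hVU (hIV fun i hi => ?_), trivial⟩, fun h => ?_⟩
  · rw [Function.update_of_ne (by rintro rfl; exact hn hi)]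
    exact (hW i hi).2
  · simpa using congrFun h n

/-- In the Cantor space, a homeomorphism argument: if `a` is
closed and is a nowhere dense subset of two nonempty perfect nowhere dense
sets `c`, `d`, then there is a self-homeomorphism of the Cantor space fixing
`a` pointwise and mapping `d` onto `c`. -/
theorem stmt16 (a c d : Set (ℕ → Bool))
    (haC : IsClosed a)
    (hc : Perfect c) (hcne : c.Nonempty) (hcN : IsNowhereDense c)
    (hd : Perfect d) (hdne : d.Nonempty) (hdN : IsNowhereDense d)
    (hac : a ⊆ c) (had : a ⊆ d)
    (hacN : interior {x : ↥c | (x : ℕ → Bool) ∈ a} = ∅)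
    (hadN : interior {x : ↥d | (x : ℕ → Bool) ∈ a} = ∅) :
    ∃ h : (ℕ → Bool) ≃ₜ (ℕ → Bool), (∀ x ∈ a, h x = x) ∧ h '' d = c :=
  IsNowhereDensePerfectPair.exists_homeomorph_image_eq (.of_interior_eq_empty haC hac hc hcN hacN)
    (.of_interior_eq_empty haC had hd hdN hadN) (iff_of_true hcne hdne) (u := fun n x => x n)
    (fun n => (IsLocallyConstant.iff_continuous _).2 (continuous_apply n)) fun _ _ => funext
end
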